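/- arXiv:1809.01207 — 2 statements merged into one kernel-verified Lean document; each statement's English description precedes it below -/
import Mathlib

section
/- For every constant ε of the form 1/(4c) with c > 0 an even integer, there is a probability distribution on n-vertex Min-Bisection instances such that, with probability 1 − o(1) over the choice of instance, both of the following hold: (1) there is a degree-Ω(n) pseudoexpectation over {±1}-valued vertex variables that satisfies x_v^2 = 1 for every vertex, satisfies the bisection identity Σ_v x_v = 0 with pseudovariance zero, and satisfies with pseudovariance zero the identity that the fraction of cut edges equals 1/4 + ε; (2) every genuine bisection cuts at least a (5/16 − ε) fraction of the edges. In particular, degree-o(n) Sum-of-Squares does not deliver a factor-(5/4 − ε) approximation for Min-Bisection. -/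
open MvPolynomial Finset

/-- Probability of an event under the uniform distribution on a finite sample space. -/
noncomputable def uprob {Ω : Type} [Fintype Ω] (p : Ω → Prop) : ℝ :=
  letI := Classical.decPred p
  ((Finset.univ.filter p).card : ℝ) / (Fintype.card Ω : ℝ)

/-- A distribution `μ` on `ι → Bool` is `j`-wise uniform: its marginal on every set of at most
`j` coordinates is uniform. -/
def kwiseUniform {ι : Type} [Fintype ι] [DecidableEq ι] (j : ℕ) (μ : (ι → Bool) → ℝ) : Prop :=
  ∀ A : Finset ι, A.card ≤ j → ∀ a : ι → Bool,
    ∑ x ∈ Finset.univ.filter (fun x : ι → Bool => ∀ i ∈ A, x i = a i), μ x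
      = (1 / 2 : ℝ) ^ A.card

/-- `μ` is a probability distribution on the finite type `α`. -/
def IsDist {α : Type} [Fintype α] (μ : α → ℝ) : Prop :=
  (∀ x, 0 ≤ μ x) ∧ ∑ x, μ x = 1

/-- The ±1 sign encoded by a Boolean (`true ↦ +1`). -/
noncomputable def sgn (b : Bool) : ℝ := if b then 1 else -1

/-- A degree-`d` pseudoexpectation over `{±1}`-valued variables `x_1, …, x_n`. -/
structure PEpm (n d : ℕ) where
  pE : MvPolynomial (Fin n) ℝ →ₗ[ℝ] ℝ
  normalized : pE 1 = 1
  multilin : ∀ p q : MvPolynomial (Fin n) ℝ,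
    (∀ x : Fin n → Bool,
        MvPolynomial.eval (fun i => sgn (x i)) p = MvPolynomial.eval (fun i => sgn (x i)) q) →
      pE p = pE q
  psd : ∀ p : MvPolynomial (Fin n) ℝ, 2 * p.totalDegree ≤ d → 0 ≤ pE (p ^ 2)

/-- The pseudoexpectation satisfies the identity `Q = b` with pseudovariance zero. -/
def PEpm.satEq {n d : ℕ} (E : PEpm n d) (Q : MvPolynomial (Fin n) ℝ) (b : ℝ) : Prop :=
  E.pE Q = b ∧ E.pE (Q ^ 2) = b ^ 2

/-- The multilinear arithmetization (in ±1 variables) of the 0/1-indicator of `x_S = a`. -/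
noncomputable def indPM {n : ℕ} {ι : Type} [Fintype ι] (S : ι → Fin n) (a : ι → Bool) :
    MvPolynomial (Fin n) ℝ :=
  ∏ i, (MvPolynomial.C (1 / 2 : ℝ) * (1 + MvPolynomial.C (sgn (a i)) * MvPolynomial.X (S i)))

/-- The arithmetization of the 0/1-indicator of the constraint "`P`, applied to the ±1 variables
of the scope `S` with signs flipped according to `z`, equals 1". -/
noncomputable def consPolyPM {n k : ℕ} (P : (Fin k → Bool) → Bool)
    (S : Fin k → Fin n) (z : Fin k → Bool) : MvPolynomial (Fin n) ℝ :=
  ∑ a ∈ Finset.univ.filter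
      (fun a : Fin k → Bool => P (fun i => Bool.xor (a i) (z i)) = true),
    indPM S a

/-- The character of `(ZMod 2)^ι` that takes the value `s i` on the `i`-th basis vector. -/
noncomputable def signChar {ι : Type} [Fintype ι] (s : ι → ℝ) (x : ι → ZMod 2) : ℝ :=
  ∏ i, if x i = 0 then 1 else s i

/-- The Walsh function on the cube indexed by `x`. -/
noncomputable def walsh {ι : Type} [Fintype ι] (x : ι → ZMod 2) : (ι → Bool) → ℝ :=
  fun z => signChar (fun i => sgn (z i)) x

lemma sgn_mul_self (b : Bool) : sgn b * sgn b = 1 := by cases b <;> simp [sgn]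

lemma sgn_not (b : Bool) : sgn (!b) = -sgn b := by cases b <;> simp [sgn]

lemma signChar_add {ι : Type} [Fintype ι] {s : ι → ℝ} (hs : ∀ i, s i * s i = 1)
    (x y : ι → ZMod 2) : signChar s (x + y) = signChar s x * signChar s y := by
  unfold signChar
  rw [← Finset.prod_mul_distrib]
  refine Finset.prod_congr rfl fun i _ => ?_
  have h2 : ∀ a b : ZMod 2, a + b = 0 ↔ (a = 0 ↔ b = 0) := by decide
  have h := hs i
  simp only [Pi.add_apply, h2]
  by_cases hx : x i = 0 <;> by_cases hy : y i = 0 <;> simp [hx, hy, h]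

lemma add_self_eq_zero_of_zmod_two {ι : Type} (x : ι → ZMod 2) : x + x = 0 :=
  funext fun _ => CharTwo.add_self_eq_zero _

lemma signChar_zero {ι : Type} [Fintype ι] (s : ι → ℝ) : signChar s 0 = 1 := by
  simp [signChar]

lemma signChar_single {ι : Type} [Fintype ι] [DecidableEq ι] (s : ι → ℝ) (i : ι) :
    signChar s (Pi.single i 1) = s i := by
  unfold signChar
  rw [Finset.prod_eq_single i] <;> simp +contextual

lemma walsh_add {ι : Type} [Fintype ι] (x y : ι → ZMod 2) :
    walsh (x + y) = walsh x * walsh y :=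
  funext fun _ => signChar_add (fun _ => sgn_mul_self _) x y

lemma walsh_zero {ι : Type} [Fintype ι] : walsh (0 : ι → ZMod 2) = 1 :=
  funext fun _ => signChar_zero _

lemma sum_walsh {ι : Type} [Fintype ι] [DecidableEq ι] (x : ι → ZMod 2) :
    ∑ z, walsh x z = if x = 0 then (2 : ℝ) ^ Fintype.card ι else 0 := by
  have h : ∑ z, walsh x z = ∏ i, ∑ b : Bool, (if x i = 0 then (1 : ℝ) else sgn b) := by
    rw [Finset.prod_univ_sum, Fintype.piFinset_univ]
    rfl
  rw [h]
  split_ifs with hx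
  · simp [hx]
  · obtain ⟨i, hi⟩ := Function.ne_iff.1 hx
    refine Finset.prod_eq_zero (Finset.mem_univ i) ?_
    simp only [Pi.zero_apply] at hi
    simp [hi, sgn]

/-- Functions on the cube of Fourier degree at most `k`. -/
noncomputable def lowDegree (ι : Type) [Fintype ι] (k : ℕ) : Submodule ℝ ((ι → Bool) → ℝ) :=
  Submodule.span ℝ (Set.range fun x : {x : ι → ZMod 2 // hammingNorm x ≤ k} => walsh x.1)

lemma walsh_mem_lowDegree {ι : Type} [Fintype ι] {x : ι → ZMod 2} {k : ℕ}
    (h : hammingNorm x ≤ k) : walsh x ∈ lowDegree ι k :=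
  Submodule.subset_span ⟨⟨x, h⟩, rfl⟩

lemma lowDegree_mono {ι : Type} [Fintype ι] {k l : ℕ} (h : k ≤ l) :
    lowDegree ι k ≤ lowDegree ι l := by
  refine Submodule.span_le.2 ?_
  rintro _ ⟨x, rfl⟩
  exact walsh_mem_lowDegree (x.2.trans h)

lemma hammingNorm_add_le {ι : Type} [Fintype ι] (x y : ι → ZMod 2) :
    hammingNorm (x + y) ≤ hammingNorm x + hammingNorm y := by
  classical
  unfold hammingNorm
  refine (Finset.card_le_card ?_).trans (Finset.card_union_le _ _)
  intro i hi
  simp only [Finset.mem_filter, Finset.mem_univ, true_and, Finset.mem_union, Pi.add_apply] at hi ⊢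
  by_contra! h
  simp [h] at hi

lemma mul_mem_lowDegree {ι : Type} [Fintype ι] {k l : ℕ} {f g : (ι → Bool) → ℝ}
    (hf : f ∈ lowDegree ι k) (hg : g ∈ lowDegree ι l) : f * g ∈ lowDegree ι (k + l) := by
  have h : lowDegree ι k * lowDegree ι l ≤ lowDegree ι (k + l) := by
    unfold lowDegree
    rw [Submodule.span_mul_span]
    refine Submodule.span_le.2 ?_
    rintro _ ⟨_, ⟨x, rfl⟩, _, ⟨y, rfl⟩, rfl⟩
    show walsh x.1 * walsh y.1 ∈ _
    rw [← walsh_add]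
    exact walsh_mem_lowDegree ((hammingNorm_add_le _ _).trans (add_le_add x.2 y.2))
  exact h (Submodule.mul_mem_mul hf hg)

lemma one_mem_lowDegree {ι : Type} [Fintype ι] (k : ℕ) : (1 : (ι → Bool) → ℝ) ∈ lowDegree ι k := by
  rw [← walsh_zero]
  exact walsh_mem_lowDegree (by simp)

lemma prod_pow_mem_lowDegree {ι σ : Type} [Fintype ι] {k : ℕ}
    {F : σ → (ι → Bool) → ℝ} (hF : ∀ v, F v ∈ lowDegree ι k) (m : σ → ℕ) (s : Finset σ) :
    ∏ v ∈ s, F v ^ m v ∈ lowDegree ι (k * ∑ v ∈ s, m v) := by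
  classical
  have hpow : ∀ v (e : ℕ), F v ^ e ∈ lowDegree ι (k * e) := by
    intro v e
    induction e with
    | zero => simpa using one_mem_lowDegree 0
    | succ e ih => rw [pow_succ, Nat.mul_succ]; exact mul_mem_lowDegree ih (hF v)
  induction s using Finset.induction_on with
  | empty => simpa using one_mem_lowDegree 0
  | insert v s hv ih =>
    rw [Finset.prod_insert hv, Finset.sum_insert hv, mul_add]
    exact mul_mem_lowDegree (hpow v _) ih

lemma aeval_mem_lowDegree {ι σ : Type} [Fintype ι] {k : ℕ}
    {F : σ → (ι → Bool) → ℝ} (hF : ∀ v, F v ∈ lowDegree ι k) (p : MvPolynomial σ ℝ) :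
    MvPolynomial.aeval F p ∈ lowDegree ι (k * p.totalDegree) := by
  rw [MvPolynomial.aeval_def, MvPolynomial.eval₂_eq]
  refine Submodule.sum_mem _ fun m hm => ?_
  rw [← Algebra.smul_def]
  refine Submodule.smul_mem _ _ (lowDegree_mono (Nat.mul_le_mul_left k ?_)
    (prod_pow_mem_lowDegree hF _ _))
  exact MvPolynomial.le_totalDegree hm

/-- A kernel that is multiplicative along its support is positive semidefinite. -/
lemma sum_kernel_nonneg {α : Type} [Fintype α] (v : α → α → ℝ)
    (hself : ∀ a, v a a = 1) (hsymm : ∀ a b, v a b = v b a)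
    (hmul : ∀ a b d, v a b ≠ 0 → v b d ≠ 0 → v a d = v a b * v b d) (t : α → ℝ) :
    0 ≤ ∑ a, ∑ b, t a * t b * v a b := by
  have hsq : ∀ a b, v a b ≠ 0 → v a b * v a b = 1 := by
    intro a b h
    have := hmul a b a h (by rwa [hsymm])
    rw [hself, hsymm b a] at this
    exact this.symm
  have hpos : ∀ a, 0 < ∑ b, v a b * v a b := fun a =>
    Finset.sum_pos' (fun b _ => mul_self_nonneg _) ⟨a, Finset.mem_univ a, by simp [hself]⟩
  have hclass : ∀ a b, v a b ≠ 0 → ∑ d, v a d * v a d = ∑ d, v b d * v b d := by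
    intro a b h
    refine Finset.sum_congr rfl fun d _ => ?_
    by_cases hd : v b d = 0
    · have : v a d = 0 := by
        by_contra hne
        have := hmul b a d (by rwa [hsymm]) hne
        rw [hd] at this
        exact (mul_ne_zero (by rwa [hsymm]) hne) this.symm
      rw [hd, this]
    · rw [hmul a b d h hd]
      linear_combination (v b d * v b d) * hsq a b h
  have hker : ∀ a b, v a b = ∑ d, (∑ e, v d e * v d e)⁻¹ * (v d a * v d b) := by
    intro a b
    have : ∀ d, (∑ e, v d e * v d e)⁻¹ * (v d a * v d b)
        = (∑ e, v a e * v a e)⁻¹ * (v a b * (v a d * v a d)) := by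
      intro d
      by_cases h : v d a = 0
      · rw [h, hsymm a d, h]; ring
      rw [hclass d a h]
      congr 1
      by_cases h' : v d b = 0
      · have : v a b = 0 := by
          by_contra hne
          have := hmul d a b h hne
          rw [h'] at this
          exact (mul_ne_zero h hne) this.symm
        rw [h', this]; ring
      · have h1 := hmul a d b (by rwa [hsymm]) h'
        have h2 := hsq d a h
        rw [h1, hsymm a d]
        linear_combination (-(v d a * v d b)) * h2
    rw [Finset.sum_congr rfl fun d _ => this d, ← Finset.mul_sum, ← Finset.mul_sum]
    rw [mul_left_comm, inv_mul_cancel₀ (hpos a).ne', mul_one]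
  have : ∑ a, ∑ b, t a * t b * v a b
      = ∑ d, (∑ e, v d e * v d e)⁻¹ * ((∑ a, t a * v d a) * (∑ a, t a * v d a)) := by
    calc ∑ a, ∑ b, t a * t b * v a b
        = ∑ a, ∑ b, ∑ d, (∑ e, v d e * v d e)⁻¹ * ((t a * v d a) * (t b * v d b)) := by
          refine Finset.sum_congr rfl fun a _ => Finset.sum_congr rfl fun b _ => ?_
          conv_lhs => rw [hker a b, Finset.mul_sum]
          exact Finset.sum_congr rfl fun d _ => by ring
      _ = ∑ d, ∑ a, ∑ b, (∑ e, v d e * v d e)⁻¹ * ((t a * v d a) * (t b * v d b)) := by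
          rw [Finset.sum_congr rfl fun b _ => Finset.sum_comm, Finset.sum_comm]
      _ = _ := by
          refine Finset.sum_congr rfl fun d _ => ?_
          rw [Finset.sum_mul_sum, Finset.mul_sum]
          exact Finset.sum_congr rfl fun a _ => (Finset.mul_sum _ _ _).symm
  rw [this]
  exact Finset.sum_nonneg fun d _ => mul_nonneg (inv_nonneg.2 (hpos d).le) (mul_self_nonneg _)

/-- The moment assigned to the parity `x` by the parity constraints `M`: the sign forced by a
combination of at most `r` constraints if there is one, and zero otherwise. -/
noncomputable def parityMoment {ι J : Type} [Fintype J] (M : (J → ZMod 2) →+ (ι → ZMod 2))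
    (b : J → ℝ) (r : ℕ) (x : ι → ZMod 2) : ℝ :=
  open Classical in
  if h : ∃ a : J → ZMod 2, hammingNorm a ≤ r ∧ M a = x then signChar b h.choose else 0

lemma exists_of_parityMoment_ne_zero {ι J : Type} [Fintype J]
    {M : (J → ZMod 2) →+ (ι → ZMod 2)} {b : J → ℝ} {r : ℕ} {x : ι → ZMod 2} (h : parityMoment M b r x ≠ 0) :
    ∃ a : J → ZMod 2, hammingNorm a ≤ r ∧ M a = x := by
  by_contra hne
  exact h (by rw [parityMoment, dif_neg hne])

section Parity

variable {ι J : Type} [Fintype ι] [Fintype J] {M : (J → ZMod 2) →+ (ι → ZMod 2)}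
  {b : J → ℝ} {r : ℕ}

lemma parityMoment_map (hM : ∀ a, hammingNorm a ≤ 2 * r → hammingNorm a ≤ hammingNorm (M a))
    {a : J → ZMod 2} (ha : hammingNorm a ≤ r) : parityMoment M b r (M a) = signChar b a := by
  have h : ∃ a' : J → ZMod 2, hammingNorm a' ≤ r ∧ M a' = M a := ⟨a, ha, rfl⟩
  rw [parityMoment, dif_pos h]
  have hsum := hM (h.choose + a)
    ((hammingNorm_add_le _ _).trans (by have := h.choose_spec.1; omega))
  rw [map_add, h.choose_spec.2, add_self_eq_zero_of_zmod_two, hammingNorm_zero,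
    Nat.le_zero, hammingNorm_eq_zero] at hsum
  congr 1
  have := congrArg (· + a) hsum
  simpa [add_assoc, add_self_eq_zero_of_zmod_two] using this

lemma parityMoment_add (hb : ∀ j, b j * b j = 1)
    (hM : ∀ a, hammingNorm a ≤ 2 * r → hammingNorm a ≤ hammingNorm (M a))
    {x y : ι → ZMod 2} (hx : parityMoment M b r x ≠ 0) (hy : parityMoment M b r y ≠ 0)
    (hxy : hammingNorm (x + y) ≤ r) :
    parityMoment M b r (x + y) = parityMoment M b r x * parityMoment M b r y := by
  obtain ⟨a, ha, rfl⟩ := exists_of_parityMoment_ne_zero hx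
  obtain ⟨a', ha', rfl⟩ := exists_of_parityMoment_ne_zero hy
  have hsum := hM (a + a') ((hammingNorm_add_le _ _).trans (by omega))
  rw [map_add] at hsum
  rw [parityMoment_map hM ha, parityMoment_map hM ha', ← map_add,
    parityMoment_map hM (hsum.trans hxy), signChar_add hb]

/-- The linear functional on functions on the cube with prescribed Walsh moments. -/
noncomputable def momentFunctional [DecidableEq ι] (v : (ι → ZMod 2) → ℝ) :
    ((ι → Bool) → ℝ) →ₗ[ℝ] ℝ :=
  ∑ x, (v x * (2 ^ Fintype.card ι)⁻¹) • ∑ z, (walsh x z) • LinearMap.proj z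

lemma momentFunctional_walsh [DecidableEq ι] (v : (ι → ZMod 2) → ℝ) (y : ι → ZMod 2) :
    momentFunctional v (walsh y) = v y := by
  have h : ∀ x, ∑ z, walsh x z * walsh y z = if x = y then (2 : ℝ) ^ Fintype.card ι else 0 := by
    intro x
    have : ∀ z, walsh x z * walsh y z = walsh (x + y) z := fun z => by rw [walsh_add]; rfl
    rw [Finset.sum_congr rfl fun z _ => this z, sum_walsh]
    have hxy : x + y = 0 ↔ x = y := by
      simp only [funext_iff, Pi.add_apply, Pi.zero_apply, CharTwo.add_eq_zero]
    simp only [hxy]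
  simp only [momentFunctional, LinearMap.coe_sum, Finset.sum_apply, LinearMap.smul_apply,
    LinearMap.proj_apply, smul_eq_mul, h]
  simp

/-- Grigoriev's linear functional for a system of parity constraints in which every combination
of few constraints involves many variables. -/
theorem exists_parity_functional [DecidableEq ι] [DecidableEq J] (hb : ∀ j, b j * b j = 1)
    (hM : ∀ a, hammingNorm a ≤ 2 * r → hammingNorm a ≤ hammingNorm (M a)) (hr : 1 ≤ r) :
    ∃ L : ((ι → Bool) → ℝ) →ₗ[ℝ] ℝ, L 1 = 1 ∧
      (∀ k, 2 * k ≤ r → ∀ f ∈ lowDegree ι k, 0 ≤ L (f * f)) ∧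
      ∀ j k, hammingNorm (M (Pi.single j 1)) + k ≤ r → ∀ f ∈ lowDegree ι k,
        L (walsh (M (Pi.single j 1)) * f) = b j * L f := by
  have hzero : parityMoment M b r 0 = 1 := by
    have := parityMoment_map (b := b) hM (a := 0) (by simp)
    rwa [map_zero, signChar_zero] at this
  refine ⟨momentFunctional (parityMoment M b r), ?_, ?_, ?_⟩
  · rw [← walsh_zero, momentFunctional_walsh, hzero]
  · intro k hk f hf
    obtain ⟨t, rfl⟩ := (Submodule.mem_span_range_iff_exists_fun ℝ).1 hf
    have hexpand : momentFunctional (parityMoment M b r)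
        ((∑ x, t x • walsh x.1) * ∑ x, t x • walsh x.1)
        = ∑ x, ∑ y, t x * t y * parityMoment M b r (x.1 + y.1) := by
      rw [Finset.sum_mul_sum, map_sum]
      refine Finset.sum_congr rfl fun x _ => ?_
      rw [map_sum]
      refine Finset.sum_congr rfl fun y _ => ?_
      rw [smul_mul_smul_comm, ← walsh_add, map_smul, momentFunctional_walsh, smul_eq_mul]
    rw [hexpand]
    refine sum_kernel_nonneg (fun x y : {x : ι → ZMod 2 // hammingNorm x ≤ k} =>
      parityMoment M b r (x.1 + y.1)) ?_ ?_ ?_ t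
    · intro x
      rw [add_self_eq_zero_of_zmod_two, hzero]
    · intro x y
      rw [add_comm]
    · intro x y z hxy hyz
      have hxz : x.1 + z.1 = (x.1 + y.1) + (y.1 + z.1) := by
        rw [add_assoc, ← add_assoc y.1, add_self_eq_zero_of_zmod_two, zero_add]
      have hle : hammingNorm (x.1 + z.1) ≤ r :=
        (hammingNorm_add_le _ _).trans ((add_le_add x.2 z.2).trans (by omega))
      rw [hxz] at hle ⊢
      exact parityMoment_add hb hM hxy hyz hle
  · intro j k hjk f hf
    obtain ⟨t, rfl⟩ := (Submodule.mem_span_range_iff_exists_fun ℝ).1 hf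
    have hj : parityMoment M b r (M (Pi.single j 1)) = b j := by
      rw [parityMoment_map hM, signChar_single]
      refine le_trans ?_ hr
      unfold hammingNorm
      rw [Finset.card_le_one]
      simp +contextual [Pi.single_apply]
    have hbj : b j ≠ 0 := fun h => by simpa [h] using hb j
    rw [Finset.mul_sum, map_sum, map_sum, Finset.mul_sum]
    refine Finset.sum_congr rfl fun x _ => ?_
    rw [mul_smul_comm, ← walsh_add, map_smul, map_smul, momentFunctional_walsh,
      momentFunctional_walsh, smul_eq_mul, smul_eq_mul, mul_left_comm (b j)]
    congr 1
    have hle : hammingNorm (M (Pi.single j 1) + x.1) ≤ r :=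
      (hammingNorm_add_le _ _).trans (by have := x.2; omega)
    by_cases hx : parityMoment M b r x.1 = 0
    · rw [hx, mul_zero]
      by_contra hne
      have hcancel : M (Pi.single j 1) + (M (Pi.single j 1) + x.1) = x.1 := by
        rw [← add_assoc, add_self_eq_zero_of_zmod_two, zero_add]
      have := parityMoment_add hb hM (hj.symm ▸ hbj) hne
        (by rw [hcancel]; have := x.2; omega)
      rw [hcancel, hx, hj] at this
      exact mul_ne_zero hbj hne this.symm
    · rw [parityMoment_add hb hM (hj.symm ▸ hbj) hx hle, hj]

end Parity

/-- The parity of the number of selected clauses containing each variable. A clause system assigns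
to every clause a literal from each of four groups of `q` variables. -/
def clauseMap {J : Type} [Fintype J] {q : ℕ} (e : J → Fin 4 → Fin q × Bool) :
    (J → ZMod 2) →+ (Fin 4 × Fin q → ZMod 2) where
  toFun a := fun p => ∑ j, if (e j p.1).1 = p.2 then a j else 0
  map_zero' := by ext; simp
  map_add' a b := by
    ext p
    simp only [Pi.add_apply, ← Finset.sum_add_distrib]
    exact Finset.sum_congr rfl fun j _ => by split_ifs <;> simp

/-- The variables occurring in the clauses of `A`. -/
def touched {J : Type} {q : ℕ} (e : J → Fin 4 → Fin q × Bool) (A : Finset J) :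
    Finset (Fin 4 × Fin q) :=
  A.biUnion fun j => Finset.univ.image fun i => (i, (e j i).1)

lemma hammingNorm_le_clauseMap {J : Type} [Fintype J] {q ρ : ℕ}
    {e : J → Fin 4 → Fin q × Bool}
    (he : ∀ A : Finset J, A.card ≤ ρ → 5 * A.card ≤ 2 * (touched e A).card)
    (a : J → ZMod 2) (ha : hammingNorm a ≤ ρ) :
    hammingNorm a ≤ hammingNorm (clauseMap e a) := by
  classical
  set A : Finset J := Finset.univ.filter fun j => a j ≠ 0 with hA
  have hAa : hammingNorm a = A.card := rfl
  rw [hAa] at ha ⊢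
  have htouch := he A ha
  have hone : ∀ j ∈ A, a j = 1 := by
    intro j hj
    have h2 : ∀ t : ZMod 2, t ≠ 0 → t = 1 := by decide
    exact h2 _ (by simpa [hA] using hj)
  set deg : Fin 4 × Fin q → ℕ := fun p => (A.filter fun j => (e j p.1).1 = p.2).card with hdeg
  have hmap : ∀ p, clauseMap e a p = (deg p : ZMod 2) := by
    intro p
    show ∑ j, (if (e j p.1).1 = p.2 then a j else 0) = _
    simp only [hdeg]
    rw [Finset.card_filter, Nat.cast_sum, hA, Finset.sum_filter]
    refine Finset.sum_congr rfl fun j _ => ?_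
    by_cases hj : a j = 0
    · simp [hj]
    · have := hone j (by simpa [hA] using hj)
      simp [this]
  have hdegsum : ∑ p, deg p = 4 * A.card := by
    simp only [hdeg, Finset.card_filter]
    rw [Finset.sum_comm, Finset.sum_const_nat (m := 4), mul_comm]
    intro j _
    rw [Fintype.sum_prod_type]
    simp
  have hpoint : ∀ p ∈ touched e A, 2 ≤ deg p + if clauseMap e a p ≠ 0 then 1 else 0 := by
    intro p hp
    have hpos : 0 < deg p := by
      simp only [touched, Finset.mem_biUnion, Finset.mem_image, Finset.mem_univ, true_and] at hp
      obtain ⟨j, hj, i, rfl⟩ := hp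
      exact Finset.card_pos.2 ⟨j, by simp [hj]⟩
    split_ifs with h
    · omega
    · rw [not_not, hmap, ZMod.natCast_eq_zero_iff] at h
      omega
  have hsum := Finset.sum_le_sum hpoint
  rw [Finset.sum_const, smul_eq_mul, Finset.sum_add_distrib] at hsum
  have h1 : ∑ p ∈ touched e A, deg p ≤ ∑ p, deg p :=
    Finset.sum_le_sum_of_subset (Finset.subset_univ _)
  have h2 : ∑ p ∈ touched e A, (if clauseMap e a p ≠ 0 then 1 else 0)
      ≤ hammingNorm (clauseMap e a) := by
    unfold hammingNorm
    rw [Finset.card_filter]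
    exact Finset.sum_le_sum_of_subset (Finset.subset_univ _)
  omega

/-- The absolute value of the sum of four signs, as a multilinear polynomial. -/
noncomputable def absSum (l : Fin 4 → ℝ) : ℝ :=
  (3 + (l 0 * l 1 + l 0 * l 2 + l 0 * l 3 + l 1 * l 2 + l 1 * l 3 + l 2 * l 3)
    - l 0 * l 1 * l 2 * l 3) / 2

lemma sgn_eq_or (b : Bool) : sgn b = 1 ∨ sgn b = -1 := by cases b <;> simp [sgn]

lemma absSum_sgn_eq (y : Fin 4 → Bool) :
    absSum (fun i => sgn (y i)) = |∑ i, sgn (y i)| := by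
  rw [Fin.sum_univ_four]
  simp only [absSum]
  rcases sgn_eq_or (y 0) with h0 | h0 <;> rcases sgn_eq_or (y 1) with h1 | h1 <;>
    rcases sgn_eq_or (y 2) with h2 | h2 <;> rcases sgn_eq_or (y 3) with h3 | h3 <;>
    rw [h0, h1, h2, h3] <;> norm_num [abs_of_nonneg, abs_of_nonpos]

lemma abs_sgn (b : Bool) : |sgn b| = 1 := by cases b <;> simp [sgn]

lemma absSum_sgn_mem (y : Fin 4 → Bool) :
    absSum (fun i => sgn (y i)) ∈ Set.Icc (0 : ℝ) 4 := by
  rw [absSum_sgn_eq]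
  refine ⟨abs_nonneg _, (Finset.abs_sum_le_sum_abs _ _).trans ?_⟩
  simp [abs_sgn]

lemma absSum_le (l : Fin 4 → ℝ) (hl : ∀ i, |l i| ≤ 1) :
    absSum l ≤ 3 / 2 + (∑ i, l i) ^ 2 / 4 := by
  have hsq : ∀ i, l i ^ 2 ≤ 1 := fun i => (sq_le_one_iff_abs_le_one _).2 (hl i)
  have h : -(l 0 * l 1 * l 2 * l 3) ≤ (l 0 ^ 2 + l 1 ^ 2 + l 2 ^ 2 + l 3 ^ 2) / 2 := by
    have h1 : -(l 0 * l 1 * (l 2 * l 3)) ≤ ((l 0 * l 1) ^ 2 + (l 2 * l 3) ^ 2) / 2 := by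
      nlinarith [sq_nonneg (l 0 * l 1 + l 2 * l 3)]
    have h2 : (l 0 * l 1) ^ 2 ≤ l 0 ^ 2 := by
      rw [mul_pow]; exact mul_le_of_le_one_right (sq_nonneg _) (hsq 1)
    have h3 : (l 2 * l 3) ^ 2 ≤ l 2 ^ 2 := by
      rw [mul_pow]; exact mul_le_of_le_one_right (sq_nonneg _) (hsq 3)
    nlinarith [sq_nonneg (l 1), sq_nonneg (l 3)]
  rw [Fin.sum_univ_four]
  unfold absSum
  nlinarith

lemma sum_mul_mul_mul {P : Type} [Fintype P] (F₀ F₁ F₂ F₃ : P → ℝ) :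
    ∑ x : Fin 4 → P, F₀ (x 0) * F₁ (x 1) * F₂ (x 2) * F₃ (x 3)
      = (∑ p, F₀ p) * (∑ p, F₁ p) * (∑ p, F₂ p) * ∑ p, F₃ p := by
  classical
  have h := Finset.prod_univ_sum (fun _ : Fin 4 => (Finset.univ : Finset P))
    (fun i p => (![F₀, F₁, F₂, F₃] : Fin 4 → P → ℝ) i p)
  rw [Fintype.piFinset_univ] at h
  simpa [Fin.prod_univ_four] using h.symm

/-- Averaging a multilinear polynomial over independent coordinates evaluates it at the means. -/
lemma sum_absSum {P : Type} [Fintype P] [Nonempty P] (y : Fin 4 → P → ℝ) :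
    ∑ x : Fin 4 → P, absSum (fun i => y i (x i))
      = (Fintype.card P : ℝ) ^ 4 * absSum fun i => (∑ p, y i p) / Fintype.card P := by
  have hP : (Fintype.card P : ℝ) ≠ 0 := by exact_mod_cast Fintype.card_ne_zero
  have hc : ∑ _x : Fin 4 → P, (3 : ℝ) = 3 * (Fintype.card P : ℝ) ^ 4 := by
    simp [mul_comm]
  have h01 := sum_mul_mul_mul (y 0) (y 1) 1 1
  have h02 := sum_mul_mul_mul (y 0) 1 (y 2) 1
  have h03 := sum_mul_mul_mul (y 0) 1 1 (y 3)
  have h12 := sum_mul_mul_mul 1 (y 1) (y 2) 1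
  have h13 := sum_mul_mul_mul 1 (y 1) 1 (y 3)
  have h23 := sum_mul_mul_mul 1 1 (y 2) (y 3)
  have h0123 := sum_mul_mul_mul (y 0) (y 1) (y 2) (y 3)
  simp only [Pi.one_apply, mul_one, one_mul, Finset.sum_const, Finset.card_univ, nsmul_eq_mul]
    at h01 h02 h03 h12 h13 h23
  unfold absSum
  rw [← Finset.sum_div, Finset.sum_sub_distrib, Finset.sum_add_distrib]
  simp only [Finset.sum_add_distrib]
  rw [hc, h01, h02, h03, h12, h13, h23, h0123]
  field_simp

/-- A Chernoff bound for sums of independent copies of a bounded centred variable. -/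
lemma card_large_sum_le {X J : Type} [Fintype X] [Fintype J] [DecidableEq J]
    (h : X → ℝ) (hbound : ∀ x, |h x| ≤ 4) (hmean : ∑ x, h x = 0)
    {η : ℝ} (hη : 0 ≤ η) (hη8 : η ≤ 8) :
    ((Finset.univ.filter fun e : J → X => (Fintype.card J : ℝ) * η < ∑ j, h (e j)).card : ℝ)
      ≤ (Fintype.card X : ℝ) ^ Fintype.card J * Real.exp (-(Fintype.card J * η ^ 2 / 64)) := by
  set θ : ℝ := η / 32 with hθ
  set m := Fintype.card J
  have hθ0 : 0 ≤ θ := by positivity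
  have hone : ∑ x, Real.exp (θ * h x) ≤ Fintype.card X * Real.exp (16 * θ ^ 2) := by
    have hpt : ∀ x, Real.exp (θ * h x) ≤ 1 + θ * h x + 16 * θ ^ 2 := by
      intro x
      have habs : |θ * h x| ≤ θ * 4 := by
        rw [abs_mul, abs_of_nonneg hθ0]; exact mul_le_mul_of_nonneg_left (hbound x) hθ0
      have h1 := Real.abs_exp_sub_one_sub_id_le (x := θ * h x) (habs.trans (by rw [hθ]; linarith))
      have h2 : (θ * h x) ^ 2 ≤ (θ * 4) ^ 2 := sq_le_sq' (neg_le_of_abs_le habs) (le_of_abs_le habs)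
      have h3 := le_of_abs_le h1
      nlinarith
    calc ∑ x, Real.exp (θ * h x) ≤ ∑ x, (1 + θ * h x + 16 * θ ^ 2) :=
          Finset.sum_le_sum fun x _ => hpt x
      _ = Fintype.card X * (16 * θ ^ 2 + 1) := by
          rw [Finset.sum_add_distrib, Finset.sum_add_distrib, ← Finset.mul_sum, hmean]
          simp; ring
      _ ≤ _ := by gcongr; exact Real.add_one_le_exp _
  have hall : ∑ e : J → X, Real.exp (θ * ∑ j, h (e j)) = (∑ x, Real.exp (θ * h x)) ^ m := by
    have := Finset.prod_univ_sum (fun _ : J => (Finset.univ : Finset X))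
      (fun _ x => Real.exp (θ * h x))
    rw [Fintype.piFinset_univ, Finset.prod_const, Finset.card_univ] at this
    rw [this]
    exact Finset.sum_congr rfl fun e _ => by rw [Finset.mul_sum, Real.exp_sum]
  set B := Finset.univ.filter fun e : J → X => (m : ℝ) * η < ∑ j, h (e j)
  have hmarkov : (B.card : ℝ) * Real.exp (θ * (m * η))
      ≤ (Fintype.card X * Real.exp (16 * θ ^ 2)) ^ m := by
    calc (B.card : ℝ) * Real.exp (θ * (m * η))
        = ∑ _e ∈ B, Real.exp (θ * (m * η)) := by rw [Finset.sum_const, nsmul_eq_mul]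
      _ ≤ ∑ e ∈ B, Real.exp (θ * ∑ j, h (e j)) := by
          refine Finset.sum_le_sum fun e he => Real.exp_le_exp.2 ?_
          exact mul_le_mul_of_nonneg_left (Finset.mem_filter.1 he).2.le hθ0
      _ ≤ ∑ e : J → X, Real.exp (θ * ∑ j, h (e j)) :=
          Finset.sum_le_univ_sum_of_nonneg fun e => Real.exp_nonneg _
      _ ≤ _ := by
          rw [hall]
          exact pow_le_pow_left₀ (Finset.sum_nonneg fun _ _ => (Real.exp_pos _).le) hone _
  rw [← le_div_iff₀ (Real.exp_pos _)] at hmarkov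
  refine hmarkov.trans (le_of_eq ?_)
  rw [mul_pow, ← Real.exp_nat_mul, mul_div_assoc, ← Real.exp_sub]
  congr 2
  rw [hθ]; ring

lemma card_touched_subset_le {J : Type} [Fintype J] [DecidableEq J] {q : ℕ} (hq : 0 < q)
    (A : Finset J) (U : Finset (Fin 4 × Fin q)) :
    ((Finset.univ.filter fun e : J → Fin 4 → Fin q × Bool => touched e A ⊆ U).card : ℝ)
      ≤ ((2 * q : ℝ) ^ 4) ^ Fintype.card J * ((U.card : ℝ) / q) ^ (4 * A.card) := by
  set S : Finset (Fin 4 → Fin q × Bool) :=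
    Fintype.piFinset fun i => Finset.univ.filter fun p => (i, p.1) ∈ U with hS
  have hScard : S.card ≤ (2 * U.card) ^ 4 := by
    rw [hS, Fintype.card_piFinset]
    refine (Finset.prod_le_pow_card _ _ (2 * U.card) fun i _ => ?_).trans (by simp)
    calc (Finset.univ.filter fun p : Fin q × Bool => (i, p.1) ∈ U).card
        ≤ (U ×ˢ (Finset.univ : Finset Bool)).card := by
          refine Finset.card_le_card_of_injOn (fun p => ((i, p.1), p.2)) ?_ ?_
          · intro p hp
            simpa using hp
          · rintro ⟨p, b⟩ _ ⟨p', b'⟩ _ h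
            simpa using h
      _ = 2 * U.card := by rw [Finset.card_product, Finset.card_univ, Fintype.card_bool, mul_comm]
  have hsub : (Finset.univ.filter fun e : J → Fin 4 → Fin q × Bool => touched e A ⊆ U)
      ⊆ Fintype.piFinset fun j => if j ∈ A then S else Finset.univ := by
    intro e he
    rw [Finset.mem_filter] at he
    rw [Fintype.mem_piFinset]
    intro j
    split_ifs with hj
    · rw [hS, Fintype.mem_piFinset]
      intro i
      simp only [Finset.mem_filter, Finset.mem_univ, true_and]
      refine he.2 ?_
      simp only [touched, Finset.mem_biUnion, Finset.mem_image, Finset.mem_univ, true_and]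
      exact ⟨j, hj, i, rfl⟩
    · exact Finset.mem_univ _
  have hcard := Finset.card_le_card hsub
  rw [Fintype.card_piFinset] at hcard
  have hprod : (∏ j : J, (if j ∈ A then S else Finset.univ).card : ℕ)
      = S.card ^ A.card * ((2 * q) ^ 4) ^ (Fintype.card J - A.card) := by
    have : ∀ j : J, (if j ∈ A then S else Finset.univ).card
        = if j ∈ A then S.card else (2 * q) ^ 4 := by
      intro j
      split_ifs
      · rfl
      · simp [mul_comm]
    rw [Finset.prod_congr rfl fun j _ => this j, Finset.prod_ite, Finset.prod_const,
      Finset.prod_const]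
    congr 2
    · congr 1; ext; simp
    · rw [← Finset.card_compl]; congr 1; ext; simp
  rw [hprod] at hcard
  have hreal : ((Finset.univ.filter fun e : J → Fin 4 → Fin q × Bool => touched e A ⊆ U).card : ℝ)
      ≤ ((2 * U.card : ℝ) ^ 4) ^ A.card * ((2 * q : ℝ) ^ 4) ^ (Fintype.card J - A.card) := by
    refine (Nat.cast_le.2 hcard).trans ?_
    push_cast
    gcongr
    exact_mod_cast hScard
  refine hreal.trans (le_of_eq ?_)
  have hq' : (q : ℝ) ≠ 0 := by exact_mod_cast hq.ne'
  have hsplit : ((2 * q : ℝ) ^ 4) ^ Fintype.card J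
      = ((2 * q : ℝ) ^ 4) ^ A.card * ((2 * q : ℝ) ^ 4) ^ (Fintype.card J - A.card) := by
    rw [← pow_add, Nat.add_sub_cancel' (Finset.card_le_univ A)]
  rw [hsplit, pow_mul, mul_right_comm, ← mul_pow, ← mul_pow]
  congr 3
  field_simp

lemma choose_le_pow_mul_exp {N k : ℕ} {x : ℝ} (hx : 0 < x) :
    (N.choose k : ℝ) ≤ (N / x) ^ k * Real.exp x := by
  have h1 := Nat.choose_le_pow_div (α := ℝ) k N
  have h2 := Real.pow_div_factorial_le_exp x hx.le k
  calc (N.choose k : ℝ) ≤ (N : ℝ) ^ k / k.factorial := h1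
    _ = (N / x) ^ k * (x ^ k / k.factorial) := by
        rw [div_pow]; field_simp
    _ ≤ _ := by gcongr

lemma expansion_union_bound_term {q K a : ℕ} (ha : 1 ≤ a) (hK : 1 ≤ K)
    (haq : a * (10 ^ 9 * K ^ 2) ≤ q) :
    ((K * q).choose a : ℝ) * ((4 * q).choose (5 * a / 2) : ℝ)
      * (((5 * a / 2 : ℕ) : ℝ) / q) ^ (4 * a) ≤ (1 / 4) ^ a := by
  have ha0 : (0 : ℝ) < a := by exact_mod_cast ha
  have hK1 : (1 : ℝ) ≤ K := by exact_mod_cast hK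
  have haq' : (a : ℝ) * (10 ^ 9 * K ^ 2) ≤ q := by exact_mod_cast haq
  have hq0 : (0 : ℝ) < q := lt_of_lt_of_le (by positivity) haq'
  set s : ℝ := √(8 * q / (5 * a)) with hs
  have hs2 : s ^ 2 = 8 * q / (5 * a) := Real.sq_sqrt (by positivity)
  have hslarge : 40000 * K ≤ s := by
    refine Real.le_sqrt_of_sq_le ?_
    rw [le_div_iff₀ (by positivity)]
    nlinarith
  have hs1 : 1 ≤ s := by linarith
  have hs0 : 0 < s := by linarith
  set u := 5 * a / 2
  have hu : 2 * u ≤ 5 * a := Nat.mul_div_le _ _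
  have hu' : (u : ℝ) ≤ 5 * a / 2 := by
    have : (2 * u : ℝ) ≤ 5 * a := by exact_mod_cast hu
    linarith
  have hqs : (q : ℝ) = 5 * a / 8 * s ^ 2 := by rw [hs2]; field_simp
  have h1 : ((K * q).choose a : ℝ) ≤ (K * (5 / 8) * s ^ 2) ^ a * Real.exp 1 ^ a := by
    have := choose_le_pow_mul_exp (N := K * q) (k := a) ha0
    rw [← Real.exp_nat_mul, mul_one]
    refine this.trans (le_of_eq ?_)
    congr 2
    push_cast
    rw [hqs]; field_simp
  have h2 : ((4 * q).choose u : ℝ) ≤ (s ^ 5) ^ a * (Real.exp 1 ^ 3) ^ a := by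
    have hx : (0 : ℝ) < 5 * a / 2 := by positivity
    have := choose_le_pow_mul_exp (N := 4 * q) (k := u) hx
    refine this.trans (mul_le_mul ?_ ?_ (Real.exp_nonneg _) (by positivity))
    · have : ((4 * q : ℕ) : ℝ) / (5 * a / 2) = s ^ 2 := by
        rw [hs2]; push_cast; field_simp; norm_num
      rw [this, ← pow_mul, ← pow_mul]
      exact pow_le_pow_right₀ hs1 hu
    · rw [← pow_mul, ← Real.exp_nat_mul, mul_one, Real.exp_le_exp]
      push_cast
      linarith
  have h3 : ((u : ℝ) / q) ^ (4 * a) ≤ ((4 / s ^ 2) ^ 4) ^ a := by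
    rw [← pow_mul]
    refine pow_le_pow_left₀ (by positivity) ?_ _
    rw [div_le_div_iff₀ hq0 (by positivity), hs2]
    calc (u : ℝ) * (8 * q / (5 * a)) ≤ (5 * a / 2) * (8 * q / (5 * a)) := by gcongr
      _ = 4 * q := by field_simp; norm_num
  calc _ ≤ ((K * (5 / 8) * s ^ 2) ^ a * Real.exp 1 ^ a) * ((s ^ 5) ^ a * (Real.exp 1 ^ 3) ^ a)
        * ((4 / s ^ 2) ^ 4) ^ a := by gcongr
    _ = (160 * Real.exp 1 ^ 4 * K / s) ^ a := by
        rw [← mul_pow, ← mul_pow, ← mul_pow, ← mul_pow]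
        congr 1
        field_simp
        norm_num
    _ ≤ (1 / 4) ^ a := by
        refine pow_le_pow_left₀ (by positivity) ?_ _
        have he : Real.exp 1 ^ 4 ≤ 55 := by
          have := Real.exp_one_lt_d9
          calc Real.exp 1 ^ 4 ≤ (2.72 : ℝ) ^ 4 := by gcongr; linarith
            _ ≤ 55 := by norm_num
        rw [div_le_div_iff₀ hs0 (by norm_num)]
        have : Real.exp 1 ^ 4 * K ≤ 55 * K := by gcongr
        nlinarith

lemma card_not_expanding_lt {q K : ℕ} (hq : 0 < q) (hK : 1 ≤ K) {ρ : ℕ}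
    (hρ : ρ * (10 ^ 9 * K ^ 2) ≤ q) :
    ((Finset.univ.filter fun e : Fin (K * q) → Fin 4 → Fin q × Bool =>
        ¬ ∀ A : Finset (Fin (K * q)), A.card ≤ ρ → 5 * A.card ≤ 2 * (touched e A).card).card : ℝ)
      ≤ ((2 * q : ℝ) ^ 4) ^ (K * q) * (1 / 2) := by
  classical
  set bad := Finset.univ.filter fun e : Fin (K * q) → Fin 4 → Fin q × Bool =>
        ¬ ∀ A : Finset (Fin (K * q)), A.card ≤ ρ → 5 * A.card ≤ 2 * (touched e A).card
  set pieces := fun a : ℕ =>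
    ((Finset.univ : Finset (Fin (K * q))).powersetCard a ×ˢ
      (Finset.univ : Finset (Fin 4 × Fin q)).powersetCard (5 * a / 2)).biUnion fun AU =>
        Finset.univ.filter fun e : Fin (K * q) → Fin 4 → Fin q × Bool => touched e AU.1 ⊆ AU.2
  have hsub : bad ⊆ (Finset.Icc 1 ρ).biUnion pieces := by
    intro e he
    simp only [bad, Finset.mem_filter, Finset.mem_univ, true_and, not_forall, not_le] at he
    obtain ⟨A, hA, hlt⟩ := he
    have hcard : A.card * 1 ≤ A.card * (10 ^ 9 * K ^ 2) :=
      Nat.mul_le_mul_left _ (Nat.one_le_iff_ne_zero.2 (by positivity))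
    have hAq : 5 * A.card / 2 ≤ 4 * q := by
      have := Nat.mul_le_mul_right (10 ^ 9 * K ^ 2) hA
      omega
    obtain ⟨U, hU, hUcard⟩ := Finset.exists_superset_card_eq (s := touched e A)
      (n := 5 * A.card / 2) (by omega) (by simpa using hAq)
    simp only [Finset.mem_biUnion, pieces, Finset.mem_product, Finset.mem_powersetCard_univ,
      Finset.mem_filter, Finset.mem_univ, true_and, Finset.mem_Icc]
    exact ⟨A.card, ⟨by omega, hA⟩, (A, U), ⟨rfl, hUcard⟩, hU⟩
  have hpiece : ∀ a ∈ Finset.Icc 1 ρ, ((pieces a).card : ℝ)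
      ≤ ((2 * q : ℝ) ^ 4) ^ (K * q) * (1 / 4) ^ a := by
    intro a ha
    rw [Finset.mem_Icc] at ha
    have hterm := expansion_union_bound_term ha.1 hK
      ((Nat.mul_le_mul_right _ ha.2).trans hρ)
    have hle : ((pieces a).card : ℝ) ≤ ∑ AU ∈ (Finset.univ : Finset (Fin (K * q))).powersetCard a ×ˢ
        (Finset.univ : Finset (Fin 4 × Fin q)).powersetCard (5 * a / 2),
          ((2 * q : ℝ) ^ 4) ^ (K * q) * (((5 * a / 2 : ℕ) : ℝ) / q) ^ (4 * a) := by
      refine (Nat.cast_le.2 Finset.card_biUnion_le).trans ?_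
      rw [Nat.cast_sum]
      refine Finset.sum_le_sum fun AU hAU => ?_
      rw [Finset.mem_product, Finset.mem_powersetCard_univ, Finset.mem_powersetCard_univ] at hAU
      have := card_touched_subset_le hq AU.1 AU.2
      rwa [Fintype.card_fin, hAU.1, hAU.2] at this
    refine hle.trans ?_
    rw [Finset.sum_const, Finset.card_product, Finset.card_powersetCard, Finset.card_powersetCard,
      nsmul_eq_mul]
    simp only [Finset.card_univ, Fintype.card_fin, Fintype.card_prod]
    push_cast
    rw [mul_left_comm]
    gcongr
  calc (bad.card : ℝ) ≤ ∑ a ∈ Finset.Icc 1 ρ, ((pieces a).card : ℝ) := by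
        exact_mod_cast (Finset.card_le_card hsub).trans Finset.card_biUnion_le
    _ ≤ ∑ a ∈ Finset.Icc 1 ρ, ((2 * q : ℝ) ^ 4) ^ (K * q) * (1 / 4) ^ a := Finset.sum_le_sum hpiece
    _ ≤ _ := by
        rw [← Finset.mul_sum]
        gcongr
        have hgeom : ∀ k : ℕ, ∑ a ∈ Finset.Icc 1 k, (1 / 4 : ℝ) ^ a ≤ 1 / 2 - (1 / 4) ^ k / 2 := by
          intro k
          induction k with
          | zero => simp
          | succ k ih =>
            rw [Finset.sum_Icc_succ_top (by omega), pow_succ]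
            have : (0 : ℝ) < (1 / 4) ^ k := by positivity
            linarith
        have : (0 : ℝ) < (1 / 4) ^ ρ := by positivity
        linarith [hgeom ρ]

/-- The empirical average of `absSum` over the clauses is at most its value at the group means,
up to `η`. -/
def Pseudorandom {J : Type} [Fintype J] {q : ℕ} (e : J → Fin 4 → Fin q × Bool) (η : ℝ) : Prop :=
  ∀ y : Fin 4 → Fin q × Bool → Bool,
    ∑ j, absSum (fun i => sgn (y i (e j i)))
      ≤ Fintype.card J * (absSum (fun i => (∑ p, sgn (y i p)) / (2 * q)) + η)

lemma card_not_pseudorandom_lt {q K : ℕ} (hq : 0 < q) {η : ℝ} (hη : 0 ≤ η) (hη8 : η ≤ 8)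
    (hK : 640 ≤ K * η ^ 2) :
    (open Classical in
      ((Finset.univ.filter fun e : Fin (K * q) → Fin 4 → Fin q × Bool =>
        ¬ Pseudorandom e η).card : ℝ))
      ≤ ((2 * q : ℝ) ^ 4) ^ (K * q) * (1 / 4) := by
  classical
  have : Nonempty (Fin q) := ⟨⟨0, hq⟩⟩
  have hq1 : (1 : ℝ) ≤ q := by exact_mod_cast hq
  set M : (Fin 4 → Fin q × Bool → Bool) → ℝ :=
    fun y => absSum (fun i => (∑ p, sgn (y i p)) / (2 * q)) with hM
  set h : (Fin 4 → Fin q × Bool → Bool) → (Fin 4 → Fin q × Bool) → ℝ :=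
    fun y x => absSum (fun i => sgn (y i (x i))) - M y with hh
  have hX : (Fintype.card (Fin 4 → Fin q × Bool) : ℝ) = (2 * q : ℝ) ^ 4 := by
    simp [mul_comm]
  have hsum : ∀ y, ∑ x : Fin 4 → Fin q × Bool, absSum (fun i => sgn (y i (x i)))
      = (2 * q : ℝ) ^ 4 * M y := by
    intro y
    rw [sum_absSum fun i p => sgn (y i p)]
    simp [hM, mul_comm]
  have hMmem : ∀ y, M y ∈ Set.Icc (0 : ℝ) 4 := by
    intro y
    have hpos : (0 : ℝ) < (2 * q) ^ 4 := by positivity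
    constructor
    · refine nonneg_of_mul_nonneg_right ?_ hpos
      rw [← hsum]
      exact Finset.sum_nonneg fun x _ => (absSum_sgn_mem _).1
    · refine le_of_mul_le_mul_left ?_ hpos
      rw [← hsum]
      refine (Finset.sum_le_sum fun x _ => (absSum_sgn_mem _).2).trans (le_of_eq ?_)
      rw [Finset.sum_const, Finset.card_univ, nsmul_eq_mul, hX]
  have hsub : (Finset.univ.filter fun e : Fin (K * q) → Fin 4 → Fin q × Bool => ¬ Pseudorandom e η)
      ⊆ Finset.univ.biUnion fun y => Finset.univ.filter fun e : Fin (K * q) → Fin 4 → Fin q × Bool =>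
          (Fintype.card (Fin (K * q)) : ℝ) * η < ∑ j, h y (e j) := by
    intro e he
    simp only [Pseudorandom, Finset.mem_filter, Finset.mem_univ, true_and, not_forall,
      not_le] at he
    obtain ⟨y, hy⟩ := he
    simp only [Finset.mem_biUnion, Finset.mem_filter, Finset.mem_univ, true_and]
    refine ⟨y, ?_⟩
    simp only [hh, Finset.sum_sub_distrib, Finset.sum_const, Finset.card_univ, nsmul_eq_mul]
    linarith
  have heach : ∀ y, ((Finset.univ.filter fun e : Fin (K * q) → Fin 4 → Fin q × Bool =>
          (Fintype.card (Fin (K * q)) : ℝ) * η < ∑ j, h y (e j)).card : ℝ)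
      ≤ ((2 * q : ℝ) ^ 4) ^ (K * q) * Real.exp (-(10 * q)) := by
    intro y
    have := card_large_sum_le (J := Fin (K * q)) (h y) ?_ ?_ hη hη8
    · rw [hX] at this
      refine this.trans ?_
      rw [Fintype.card_fin]
      gcongr
      push_cast
      nlinarith
    · intro x
      have h1 := hMmem y
      have h2 := absSum_sgn_mem fun i => y i (x i)
      rw [abs_le]
      constructor <;> simp only [hh] <;> linarith [h1.1, h1.2, h2.1, h2.2]
    · simp only [hh, Finset.sum_sub_distrib, Finset.sum_const, Finset.card_univ, nsmul_eq_mul]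
      rw [hsum, hX, sub_self]
  have hcount : (Fintype.card (Fin 4 → Fin q × Bool → Bool) : ℝ) = 2 ^ (8 * q) := by
    simp [← pow_mul]
    ring
  calc _ ≤ ∑ y : Fin 4 → Fin q × Bool → Bool,
        ((2 * q : ℝ) ^ 4) ^ (K * q) * Real.exp (-(10 * q)) := by
        refine (Nat.cast_le.2 ((Finset.card_le_card hsub).trans Finset.card_biUnion_le)).trans ?_
        rw [Nat.cast_sum]
        exact Finset.sum_le_sum fun y _ => heach y
    _ = ((2 * q : ℝ) ^ 4) ^ (K * q) * (2 ^ (8 * q) * Real.exp (-(10 * q))) := by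
        rw [Finset.sum_const, Finset.card_univ, nsmul_eq_mul, hcount]; ring
    _ ≤ _ := by
        gcongr
        have he : (2 : ℝ) ≤ Real.exp 1 := by linarith [Real.add_one_le_exp (1 : ℝ)]
        calc (2 : ℝ) ^ (8 * q) * Real.exp (-(10 * q))
            ≤ Real.exp 1 ^ (8 * q) * Real.exp (-(10 * q)) := by gcongr
          _ = Real.exp (-(2 * q)) := by
              rw [← Real.exp_nat_mul, ← Real.exp_add]; congr 1; push_cast; ring
          _ ≤ Real.exp (-2) := Real.exp_le_exp.2 (by linarith)
          _ = (Real.exp 1 ^ 2)⁻¹ := by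
              rw [← Real.exp_nat_mul, ← Real.exp_neg]; norm_num
          _ ≤ 1 / 4 := by
              rw [inv_eq_one_div]
              exact one_div_le_one_div_of_le (by norm_num) (by nlinarith)

theorem exists_clause_system {q K ρ : ℕ} (hq : 0 < q) (hK : 1 ≤ K)
    (hρ : ρ * (10 ^ 9 * K ^ 2) ≤ q) {η : ℝ} (hη : 0 ≤ η) (hη8 : η ≤ 8) (hKη : 640 ≤ K * η ^ 2) :
    ∃ e : Fin (K * q) → Fin 4 → Fin q × Bool,
      (∀ A : Finset (Fin (K * q)), A.card ≤ ρ → 5 * A.card ≤ 2 * (touched e A).card) ∧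
      Pseudorandom e η := by
  classical
  by_contra! hno
  have h1 := card_not_expanding_lt hq hK hρ
  have h2 := card_not_pseudorandom_lt hq hη hη8 hKη
  have hcover : (Finset.univ : Finset (Fin (K * q) → Fin 4 → Fin q × Bool))
      ⊆ (Finset.univ.filter fun e => ¬ ∀ A : Finset (Fin (K * q)), A.card ≤ ρ →
          5 * A.card ≤ 2 * (touched e A).card)
        ∪ Finset.univ.filter fun e => ¬ Pseudorandom e η := by
    intro e _
    simp only [Finset.mem_union, Finset.mem_filter, Finset.mem_univ, true_and]
    by_contra! h
    exact hno e h.1 h.2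
  have h3 : ((Finset.univ : Finset (Fin (K * q) → Fin 4 → Fin q × Bool)).card : ℝ) ≤ _ :=
    Nat.cast_le.2 ((Finset.card_le_card hcover).trans (Finset.card_union_le _ _))
  have hcard : ((Finset.univ : Finset (Fin (K * q) → Fin 4 → Fin q × Bool)).card : ℝ)
      = ((2 * q : ℝ) ^ 4) ^ (K * q) := by
    simp [mul_comm]
  rw [hcard] at h3
  push_cast at h3
  have hpos : (0 : ℝ) < ((2 * q : ℝ) ^ 4) ^ (K * q) := by
    have : (0 : ℝ) < q := by exact_mod_cast hq
    positivity
  linarith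

section Completeness

variable {q m : ℕ}

/-- The value of the `i`-th literal of clause `j`. -/
noncomputable def lit (e : Fin m → Fin 4 → Fin q × Bool) (j : Fin m) (i : Fin 4) :
    (Fin 4 × Fin q → Bool) → ℝ :=
  fun z => sgn (e j i).2 * sgn (z (i, (e j i).1))

/-- The majority of the first three literals of clause `j`. -/
noncomputable def maj (e : Fin m → Fin 4 → Fin q × Bool) (j : Fin m) :
    (Fin 4 × Fin q → Bool) → ℝ :=
  (1 / 2 : ℝ) • (lit e j 0 + lit e j 1 + lit e j 2 - lit e j 0 * lit e j 1 * lit e j 2)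

/-- The sum of the products of two literals of clause `j`, recentred. -/
noncomputable def pairSum (e : Fin m → Fin 4 → Fin q × Bool) (j : Fin m) :
    (Fin 4 × Fin q → Bool) → ℝ :=
  lit e j 0 * lit e j 1 + lit e j 0 * lit e j 2 + lit e j 0 * lit e j 3 + lit e j 1 * lit e j 2
    + lit e j 1 * lit e j 3 + lit e j 2 * lit e j 3 - (2 : ℝ) • 1

lemma walsh_single (p : Fin 4 × Fin q) :
    walsh (Pi.single p 1) = fun z => sgn (z p) :=
  funext fun _ => signChar_single _ _

lemma sgn_mem_lowDegree (p : Fin 4 × Fin q) :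
    (fun z : Fin 4 × Fin q → Bool => sgn (z p)) ∈ lowDegree (Fin 4 × Fin q) 1 := by
  rw [← walsh_single]
  refine walsh_mem_lowDegree ?_
  unfold hammingNorm
  rw [Finset.card_le_one]
  simp +contextual [Pi.single_apply]

lemma lit_mem_lowDegree (e : Fin m → Fin 4 → Fin q × Bool) (j : Fin m) (i : Fin 4) :
    lit e j i ∈ lowDegree (Fin 4 × Fin q) 1 :=
  Submodule.smul_mem _ (sgn (e j i).2) (sgn_mem_lowDegree _)

lemma maj_mem_lowDegree (e : Fin m → Fin 4 → Fin q × Bool) (j : Fin m) :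
    maj e j ∈ lowDegree (Fin 4 × Fin q) 3 := by
  have hl : ∀ i, lit e j i ∈ lowDegree (Fin 4 × Fin q) 3 := fun i =>
    lowDegree_mono (by norm_num) (lit_mem_lowDegree e j i)
  have hprod : lit e j 0 * lit e j 1 * lit e j 2 ∈ lowDegree (Fin 4 × Fin q) 3 :=
    mul_mem_lowDegree (k := 2) (l := 1)
      (mul_mem_lowDegree (k := 1) (l := 1) (lit_mem_lowDegree e j 0) (lit_mem_lowDegree e j 1))
      (lit_mem_lowDegree e j 2)
  unfold maj
  exact Submodule.smul_mem _ _
    (Submodule.sub_mem _ (Submodule.add_mem _ (Submodule.add_mem _ (hl 0) (hl 1)) (hl 2)) hprod)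

lemma pairSum_mem_lowDegree (e : Fin m → Fin 4 → Fin q × Bool) (j : Fin m) :
    pairSum e j ∈ lowDegree (Fin 4 × Fin q) 2 := by
  have hl := fun i i' => mul_mem_lowDegree (lit_mem_lowDegree e j i) (lit_mem_lowDegree e j i')
  exact sub_mem (add_mem (add_mem (add_mem (add_mem (add_mem (hl 0 1) (hl 0 2)) (hl 0 3))
    (hl 1 2)) (hl 1 3)) (hl 2 3)) (Submodule.smul_mem _ _ (one_mem_lowDegree _))

lemma lit_eq_or (e : Fin m → Fin 4 → Fin q × Bool) (j : Fin m) (i : Fin 4)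
    (z : Fin 4 × Fin q → Bool) : lit e j i z = 1 ∨ lit e j i z = -1 := by
  unfold lit
  rcases sgn_eq_or (e j i).2 with h | h <;> rcases sgn_eq_or (z (i, (e j i).1)) with h' | h' <;>
    simp [h, h']

lemma maj_eq_or (e : Fin m → Fin 4 → Fin q × Bool) (j : Fin m)
    (z : Fin 4 × Fin q → Bool) : maj e j z = 1 ∨ maj e j z = -1 := by
  simp only [maj, Pi.smul_apply, Pi.sub_apply, Pi.add_apply, Pi.mul_apply, smul_eq_mul]
  rcases lit_eq_or e j 0 z with h0 | h0 <;> rcases lit_eq_or e j 1 z with h1 | h1 <;>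
    rcases lit_eq_or e j 2 z with h2 | h2 <;> rw [h0, h1, h2] <;> norm_num

/-- The majority vertex of a clause cuts one of its four literals, up to a multiple of the parity
constraint. -/
lemma sum_maj_sub_lit_sq (e : Fin m → Fin 4 → Fin q × Bool) (j : Fin m) :
    ∑ i, (maj e j - lit e j i) ^ 2
      = (4 : ℝ) • 1 - (1 / 2 : ℝ) • ((1 + ∏ i, lit e j i) * pairSum e j) := by
  funext z
  simp only [Fin.sum_univ_four, Fin.prod_univ_four, maj, pairSum, Pi.smul_apply, Pi.sub_apply,
    Pi.add_apply, Pi.mul_apply, Pi.pow_apply, Pi.one_apply, smul_eq_mul]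
  rcases lit_eq_or e j 0 z with h0 | h0 <;> rcases lit_eq_or e j 1 z with h1 | h1 <;>
    rcases lit_eq_or e j 2 z with h2 | h2 <;> rcases lit_eq_or e j 3 z with h3 | h3 <;>
    rw [h0, h1, h2, h3] <;> norm_num

lemma clauseMap_single (e : Fin m → Fin 4 → Fin q × Bool) (j : Fin m) (p : Fin 4 × Fin q) :
    clauseMap e (Pi.single j 1) p = if (e j p.1).1 = p.2 then 1 else 0 := by
  show ∑ j', (if (e j' p.1).1 = p.2 then (Pi.single j 1 : Fin m → ZMod 2) j' else 0) = _
  rw [Finset.sum_eq_single j] <;> simp +contextual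

lemma hammingNorm_clauseMap_single (e : Fin m → Fin 4 → Fin q × Bool) (j : Fin m) :
    hammingNorm (clauseMap e (Pi.single j 1)) ≤ 4 := by
  unfold hammingNorm
  calc _ ≤ (Finset.univ.image fun i : Fin 4 => (i, (e j i).1)).card := by
        refine Finset.card_le_card ?_
        rintro ⟨i, v⟩ h
        simpa [clauseMap_single] using h
    _ ≤ 4 := Finset.card_image_le.trans (by simp)

lemma walsh_clauseMap_single (e : Fin m → Fin 4 → Fin q × Bool) (j : Fin m) :
    ∏ i, lit e j i = (∏ i, sgn (e j i).2) • walsh (clauseMap e (Pi.single j 1)) := by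
  funext z
  rw [Finset.prod_apply, Pi.smul_apply, smul_eq_mul]
  simp only [lit, Finset.prod_mul_distrib]
  congr 1
  simp only [walsh, signChar, clauseMap_single]
  rw [Fintype.prod_prod_type]
  refine Finset.prod_congr rfl fun i _ => ?_
  rw [Finset.prod_eq_single (e j i).1]
  · simp
  · intro v _ hv
    simp [hv.symm]
  · simp

/-- A functional that behaves as if every clause contained an odd number of true literals. -/
theorem exists_clause_functional (e : Fin m → Fin 4 → Fin q × Bool) {r : ℕ} (hr : 1 ≤ r)
    (he : ∀ A : Finset (Fin m), A.card ≤ 2 * r → 5 * A.card ≤ 2 * (touched e A).card) :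
    ∃ L : ((Fin 4 × Fin q → Bool) → ℝ) →ₗ[ℝ] ℝ, L 1 = 1 ∧
      (∀ k, 2 * k ≤ r → ∀ f ∈ lowDegree (Fin 4 × Fin q) k, 0 ≤ L (f * f)) ∧
      ∀ j k, 4 + k ≤ r → ∀ f ∈ lowDegree (Fin 4 × Fin q) k,
        L ((1 + ∏ i, lit e j i) * f) = 0 := by
  have hβ : ∀ j, (∏ i, sgn (e j i).2) * ∏ i, sgn (e j i).2 = 1 := by
    intro j
    rw [← Finset.prod_mul_distrib]
    exact Finset.prod_eq_one fun i _ => sgn_mul_self _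
  obtain ⟨L, h1, hpsd, hclause⟩ := exists_parity_functional (M := clauseMap e)
    (b := fun j => -∏ i, sgn (e j i).2) (r := r) (fun j => by rw [neg_mul_neg]; exact hβ j)
    (hammingNorm_le_clauseMap he) hr
  refine ⟨L, h1, hpsd, fun j k hk f hf => ?_⟩
  have hL := hclause j k (by have := hammingNorm_clauseMap_single e j; omega) f hf
  rw [walsh_clauseMap_single, add_mul, one_mul, map_add, smul_mul_assoc, map_smul, hL, smul_eq_mul]
  linear_combination (-(L f)) * hβ j

end Completeness

/-- Half of the vertices of the graph: `T` copies of every variable, a vertex for every clause,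
and `R` isolated vertices. The other half consists of their negations. -/
abbrev HalfVertex (q m T R : ℕ) : Type := (Fin 4 × Fin q × Fin T) ⊕ (Fin m ⊕ Fin R)

/-- The edges of the graph: each clause vertex is joined to all copies of its literals, and some
copies of each variable are joined to copies of its negation. -/
abbrev EdgeIndex (q m T K L : ℕ) : Type :=
  (Fin m × Bool × Fin 4 × Fin T) ⊕ (Fin 4 × Fin q × Fin (2 * K) × Fin L)

/-- The endpoints of an edge. -/
def endpoints {q m T K L : ℕ} (R : ℕ) (e : Fin m → Fin 4 → Fin q × Bool) (hK : 2 * K ≤ T)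
    (hL : L ≤ T) :
    EdgeIndex q m T K L → (HalfVertex q m T R × Bool) × (HalfVertex q m T R × Bool)
  | .inl (j, s, i, t) => ((.inr (.inl j), s), (.inl (i, (e j i).1, t), s == (e j i).2))
  | .inr (i, v, a, b) =>
    ((.inl (i, v, Fin.castLE hK a), true), (.inl (i, v, Fin.castLE hL b), false))

lemma endpoints_injective {q m T K L : ℕ} (R : ℕ) (e : Fin m → Fin 4 → Fin q × Bool)
    (hK : 2 * K ≤ T) (hL : L ≤ T) : Function.Injective (endpoints R e hK hL) := by
  rintro (⟨j, s, i, t⟩ | ⟨i, v, a, b⟩) (⟨j', s', i', t'⟩ | ⟨i', v', a', b'⟩) h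
  · simp only [endpoints, Prod.mk.injEq, Sum.inr.injEq, Sum.inl.injEq] at h
    obtain ⟨⟨rfl, rfl⟩, ⟨rfl, -, rfl⟩, -⟩ := h
    rfl
  · simp [endpoints] at h
  · simp [endpoints] at h
  · simp only [endpoints, Prod.mk.injEq, Sum.inl.injEq, Fin.castLE_inj] at h
    obtain ⟨⟨⟨rfl, rfl, rfl⟩, -⟩, ⟨-, -, rfl⟩, -⟩ := h
    rfl

lemma endpoints_ne {q m T K L : ℕ} (R : ℕ) (e : Fin m → Fin 4 → Fin q × Bool)
    (hK : 2 * K ≤ T) (hL : L ≤ T) (d : EdgeIndex q m T K L) :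
    (endpoints R e hK hL d).1 ≠ (endpoints R e hK hL d).2 := by
  rcases d with ⟨j, s, i, t⟩ | ⟨i, v, a, b⟩ <;> simp [endpoints]

/-- The value of a vertex as a function of the variables. -/
noncomputable def halfValue {q m T R : ℕ} (e : Fin m → Fin 4 → Fin q × Bool) :
    HalfVertex q m T R → (Fin 4 × Fin q → Bool) → ℝ
  | .inl (i, v, _) => fun z => sgn (z (i, v))
  | .inr (.inl j) => maj e j
  | .inr (.inr _) => 1

/-- The value of a possibly negated vertex as a function of the variables. -/
noncomputable def vertexValue {q m T R : ℕ} (e : Fin m → Fin 4 → Fin q × Bool)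
    (w : HalfVertex q m T R × Bool) : (Fin 4 × Fin q → Bool) → ℝ :=
  sgn w.2 • halfValue e w.1

lemma halfValue_mem_lowDegree {q m T R : ℕ} (e : Fin m → Fin 4 → Fin q × Bool)
    (w : HalfVertex q m T R) : halfValue e w ∈ lowDegree (Fin 4 × Fin q) 3 := by
  rcases w with ⟨i, v, t⟩ | j | r
  · exact lowDegree_mono (by norm_num) (sgn_mem_lowDegree _)
  · exact maj_mem_lowDegree e j
  · exact one_mem_lowDegree _

lemma vertexValue_eq_sgn {q m T R : ℕ} (e : Fin m → Fin 4 → Fin q × Bool)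
    (w : HalfVertex q m T R × Bool) (z : Fin 4 × Fin q → Bool) :
    ∃ b : Bool, vertexValue e w z = sgn b := by
  have hhalf : halfValue e w.1 z = 1 ∨ halfValue e w.1 z = -1 := by
    rcases w with ⟨⟨i, v, t⟩ | j | r, s⟩
    · exact sgn_eq_or _
    · exact maj_eq_or e j z
    · exact Or.inl rfl
  have hval : vertexValue e w z = sgn w.2 * halfValue e w.1 z := rfl
  rw [hval]
  rcases hhalf with h | h
  · exact ⟨w.2, by rw [h, mul_one]⟩
  · exact ⟨!w.2, by rw [h, sgn_not]; ring⟩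

lemma sum_vertexValue {q m T R : ℕ} (e : Fin m → Fin 4 → Fin q × Bool) :
    ∑ w : HalfVertex q m T R × Bool, vertexValue e w = 0 := by
  rw [Fintype.sum_prod_type]
  refine Finset.sum_eq_zero fun w _ => ?_
  simp [vertexValue, sgn]

lemma sgn_beq (s b : Bool) : sgn (s == b) = sgn s * sgn b := by
  cases s <;> cases b <;> simp [sgn]

lemma sum_cut_vertexValue {q m T R K L : ℕ} (e : Fin m → Fin 4 → Fin q × Bool)
    (hK : 2 * K ≤ T) (hL : L ≤ T) :
    ∑ d : EdgeIndex q m T K L, (vertexValue e (endpoints R e hK hL d).1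
        - vertexValue e (endpoints R e hK hL d).2) ^ 2
      = (8 * m * T + 32 * K * q * L : ℝ) • 1
        - (T : ℝ) • ∑ j, (1 + ∏ i, lit e j i) * pairSum e j := by
  have hclause : ∀ j s i t, (vertexValue e (endpoints R e hK hL (.inl (j, s, i, t))).1
        - vertexValue e (endpoints R e hK hL (.inl (j, s, i, t))).2) ^ 2
        = (maj e j - lit e j i) ^ 2 := by
    intro j s i t
    funext z
    simp only [endpoints, vertexValue, halfValue, lit, sgn_beq, Pi.pow_apply, Pi.sub_apply,
      Pi.smul_apply, smul_eq_mul]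
    linear_combination (maj e j z - sgn (e j i).2 * sgn (z (i, (e j i).1))) ^ 2 * sgn_mul_self s
  have hvar : ∀ i v a b, (vertexValue e (endpoints R e hK hL (.inr (i, v, a, b))).1
        - vertexValue e (endpoints R e hK hL (.inr (i, v, a, b))).2) ^ 2
        = (4 : ℝ) • 1 := by
    intro i v a b
    funext z
    have := sgn_mul_self (z (i, v))
    simp only [endpoints, vertexValue, halfValue, Pi.pow_apply, Pi.sub_apply,
      Pi.smul_apply, smul_eq_mul, Pi.one_apply]
    simp only [sgn, if_true, Bool.false_eq_true, if_false] at this ⊢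
    linear_combination 4 * this
  rw [Fintype.sum_sum_type]
  simp only [Fintype.sum_prod_type, hclause, hvar, Finset.sum_const, Finset.card_univ,
    Fintype.card_fin, Fintype.card_bool]
  have hswap : ∀ j, ∑ i : Fin 4, T • (maj e j - lit e j i) ^ 2
      = T • ((4 : ℝ) • 1 - (1 / 2 : ℝ) • ((1 + ∏ i, lit e j i) * pairSum e j)) := by
    intro j
    rw [← Finset.smul_sum, sum_maj_sub_lit_sq]
  simp only [hswap]
  funext z
  simp only [Pi.add_apply, Finset.sum_apply, Pi.sub_apply, Pi.smul_apply, Pi.one_apply,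
    Pi.mul_apply, nsmul_eq_mul, Pi.natCast_apply, smul_eq_mul, mul_sub, Finset.sum_sub_distrib,
    Finset.sum_const, Finset.card_univ, Fintype.card_fin, Fintype.card_prod, Finset.mul_sum]
  push_cast
  have hhalf : ∀ x : ℝ, 2 * ((T : ℝ) * (1 / 2 * x)) = T * x := fun x => by ring
  simp only [hhalf]
  ring

section Soundness

lemma sum_sum_coordinates {P : Type} [Fintype P] (F : Fin 4 → P → ℝ) :
    ∑ x : Fin 4 → P, ∑ i, F i (x i) = (Fintype.card P : ℝ) ^ 3 * ∑ i, ∑ p, F i p := by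
  have h0 := sum_mul_mul_mul (F 0) 1 1 1
  have h1 := sum_mul_mul_mul 1 (F 1) 1 1
  have h2 := sum_mul_mul_mul 1 1 (F 2) 1
  have h3 := sum_mul_mul_mul 1 1 1 (F 3)
  simp only [Pi.one_apply, mul_one, one_mul, Finset.sum_const, Finset.card_univ, nsmul_eq_mul]
    at h0 h1 h2 h3
  simp only [Fin.sum_univ_four, Finset.sum_add_distrib, h0, h1, h2, h3]
  ring

lemma abs_sum_sgn_le {P : Type} [Fintype P] (y : P → Bool) :
    |∑ p, sgn (y p)| ≤ Fintype.card P :=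
  (Finset.abs_sum_le_sum_abs _ _).trans (by simp [abs_sgn])

/-- In a pseudorandom clause system, no assignment to clauses and to copies of literals makes
clauses agree with many copies of their literals. -/
lemma Pseudorandom.sum_mul_copies_le {q m T : ℕ} {e : Fin m → Fin 4 → Fin q × Bool} {η : ℝ}
    (he : Pseudorandom e η) (hq : 0 < q) (hT : 0 < T) (w : Fin m → Bool)
    (Y : Fin 4 → Fin T → Fin q × Bool → Bool) :
    ∑ j, ∑ i, ∑ t, sgn (w j) * sgn (Y i t (e j i))
      ≤ m * T * (3 / 2 + ((∑ i, ∑ t, ∑ p, sgn (Y i t p)) / (2 * q * T)) ^ 2 / 4 + η) := by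
  have hq' : (0 : ℝ) < q := by exact_mod_cast hq
  have hT' : (0 : ℝ) < T := by exact_mod_cast hT
  have : Nonempty (Fin T) := ⟨⟨0, hT⟩⟩
  have hmean : ∀ (i : Fin 4) (t : Fin T), |(∑ p, sgn (Y i t p)) / (2 * q)| ≤ 1 := by
    intro i t
    rw [abs_div, abs_of_pos (by positivity : (0 : ℝ) < 2 * q), div_le_one (by positivity)]
    refine (abs_sum_sgn_le _).trans (le_of_eq ?_)
    simp [mul_comm]
  have hmean' : ∀ i : Fin 4, |(∑ t, (∑ p, sgn (Y i t p)) / (2 * q)) / T| ≤ 1 := by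
    intro i
    rw [abs_div, abs_of_pos hT', div_le_one hT']
    refine (Finset.abs_sum_le_sum_abs _ _).trans
      ((Finset.sum_le_sum fun t _ => hmean i t).trans (le_of_eq ?_))
    simp
  have hlhs : (T : ℝ) ^ 3 * ∑ j, ∑ i, ∑ t, sgn (w j) * sgn (Y i t (e j i))
      = ∑ x : Fin 4 → Fin T, ∑ j, sgn (w j) * ∑ i, sgn (Y i (x i) (e j i)) := by
    rw [Finset.sum_comm (s := Finset.univ (α := Fin 4 → Fin T)), Finset.mul_sum]
    refine Finset.sum_congr rfl fun j _ => ?_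
    have := sum_sum_coordinates fun i (t : Fin T) => sgn (w j) * sgn (Y i t (e j i))
    rw [Fintype.card_fin] at this
    simp only [Finset.mul_sum] at this ⊢
    exact this.symm
  have hx : ∀ x : Fin 4 → Fin T, ∑ j, sgn (w j) * ∑ i, sgn (Y i (x i) (e j i))
      ≤ m * (absSum (fun i => (∑ p, sgn (Y i (x i) p)) / (2 * q)) + η) := by
    intro x
    have h := he fun i => Y i (x i)
    rw [Fintype.card_fin] at h
    refine (Finset.sum_le_sum fun j _ => ?_).trans h
    rw [absSum_sgn_eq fun i => Y i (x i) (e j i)]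
    refine (le_abs_self _).trans (le_of_eq ?_)
    rw [abs_mul, abs_sgn, one_mul]
  have hsum := sum_absSum fun i (t : Fin T) => (∑ p, sgn (Y i t p)) / (2 * q : ℝ)
  have hle := absSum_le _ hmean'
  have hσ : ∑ i, (∑ t, (∑ p, sgn (Y i t p)) / (2 * q)) / T
      = (∑ i, ∑ t, ∑ p, sgn (Y i t p)) / (2 * q * T : ℝ) := by
    simp only [← Finset.sum_div, div_div]
  rw [hσ] at hle
  rw [Fintype.card_fin] at hsum
  refine le_of_mul_le_mul_left ?_ (pow_pos hT' 3)
  rw [hlhs]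
  refine (Finset.sum_le_sum fun x _ => hx x).trans ?_
  rw [← Finset.mul_sum, Finset.sum_add_distrib, hsum, Finset.sum_const, Finset.card_univ,
    Fintype.card_fun, Fintype.card_fin, Fintype.card_fin, nsmul_eq_mul]
  push_cast
  calc _ = m * (T : ℝ) ^ 4
          * (absSum (fun i => (∑ t, (∑ p, sgn (Y i t p)) / (2 * q)) / (T : ℝ)) + η) := by
        ring
    _ ≤ m * (T : ℝ) ^ 4 * (3 / 2 + ((∑ i, ∑ t, ∑ p, sgn (Y i t p)) / (2 * q * T)) ^ 2 / 4 + η) := by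
        gcongr
    _ = _ := by ring

/-- The number of cut edges in an arbitrary bisection. -/
lemma Pseudorandom.le_card_cut {q m T K L R : ℕ} {e : Fin m → Fin 4 → Fin q × Bool} {η κ : ℝ}
    (he : Pseudorandom e η) (hq : 0 < q) (hT : 0 < T) (hK : 2 * K ≤ T) (hL : L ≤ T)
    (hκ : (m + R : ℝ) ≤ κ * (q * T)) (y : HalfVertex q m T R × Bool → Bool)
    (hy : ∑ w, sgn (y w) = 0) :
    m * T * (5 / 2 - κ ^ 2 / 4 - η) ≤ ((Finset.univ.filter fun d : EdgeIndex q m T K L =>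
      y (endpoints R e hK hL d).1 ≠ y (endpoints R e hK hL d).2).card : ℝ) := by
  have hq' : (0 : ℝ) < q := by exact_mod_cast hq
  have hT' : (0 : ℝ) < T := by exact_mod_cast hT
  have hind : ∀ a b : Bool, (if a ≠ b then (1 : ℝ) else 0) = (1 - sgn a * sgn b) / 2 := by
    intro a b; cases a <;> cases b <;> norm_num [sgn]
  have hS : |∑ i : Fin 4, ∑ v : Fin q, ∑ t : Fin T, ∑ s : Bool, sgn (y (.inl (i, v, t), s))|
      ≤ 2 * (m + R) := by
    have hsplit : (∑ i : Fin 4, ∑ v : Fin q, ∑ t : Fin T, ∑ s : Bool, sgn (y (.inl (i, v, t), s)))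
        + ∑ u : (Fin m ⊕ Fin R) × Bool, sgn (y (.inr u.1, u.2)) = 0 := by
      rw [← hy]
      simp only [Fintype.sum_prod_type, Fintype.sum_sum_type]
    rw [eq_neg_of_add_eq_zero_left hsplit, abs_neg]
    refine (abs_sum_sgn_le _).trans (le_of_eq ?_)
    simp [mul_comm]
  have hs : ∀ s : Bool, ∑ j, ∑ i, ∑ t : Fin T, sgn (y (.inr (.inl j), s))
        * sgn (y (.inl (i, (e j i).1, t), s == (e j i).2))
      ≤ m * T * (3 / 2 + κ ^ 2 / 4 + η) := by
    intro s
    refine (he.sum_mul_copies_le hq hT (fun j => y (.inr (.inl j), s))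
      fun i t p => y (.inl (i, p.1, t), s == p.2)).trans ?_
    have hre : ∑ i : Fin 4, ∑ t : Fin T, ∑ p : Fin q × Bool, sgn (y (.inl (i, p.1, t), s == p.2))
        = ∑ i : Fin 4, ∑ v : Fin q, ∑ t : Fin T, ∑ s : Bool, sgn (y (.inl (i, v, t), s)) := by
      refine Finset.sum_congr rfl fun i _ => ?_
      simp only [Fintype.sum_prod_type]
      rw [Finset.sum_comm]
      refine Finset.sum_congr rfl fun v _ => Finset.sum_congr rfl fun t _ => ?_
      cases s <;> simp [add_comm]
    rw [hre]
    have hσ : ((∑ i : Fin 4, ∑ v : Fin q, ∑ t : Fin T, ∑ s : Bool,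
        sgn (y (.inl (i, v, t), s))) / (2 * q * T)) ^ 2 ≤ κ ^ 2 := by
      refine sq_le_sq' ?_ ?_
      · rw [le_div_iff₀ (by positivity)]
        linarith [(abs_le.1 hS).1]
      · rw [div_le_iff₀ (by positivity)]
        linarith [(abs_le.1 hS).2]
    gcongr
  rw [Finset.card_filter]
  push_cast
  simp only [hind]
  rw [Fintype.sum_sum_type]
  have hvar : 0 ≤ ∑ d : Fin 4 × Fin q × Fin (2 * K) × Fin L,
      (1 - sgn (y (endpoints R e hK hL (.inr d)).1) * sgn (y (endpoints R e hK hL (.inr d)).2)) / 2 :=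
    Finset.sum_nonneg fun d _ => by rw [← hind]; split_ifs <;> norm_num
  have hclause : ∑ d : Fin m × Bool × Fin 4 × Fin T,
      (1 - sgn (y (endpoints R e hK hL (.inl d)).1) * sgn (y (endpoints R e hK hL (.inl d)).2)) / 2
      = (8 * m * T - ∑ s, ∑ j, ∑ i, ∑ t : Fin T, sgn (y (.inr (.inl j), s))
        * sgn (y (.inl (i, (e j i).1, t), s == (e j i).2))) / 2 := by
    rw [← Finset.sum_div, Finset.sum_sub_distrib, Finset.sum_comm (s := Finset.univ (α := Bool))]
    simp only [Fintype.sum_prod_type, endpoints]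
    simp
    ring
  rw [hclause, Fintype.sum_bool]
  linarith [hs true, hs false]

end Soundness

/-- The pseudoexpectation obtained by substituting `±1`-valued functions for the variables in a
functional that is nonnegative on squares of low degree. -/
noncomputable def PEpm.ofFunctional {ι : Type} [Fintype ι] {n d k r : ℕ}
    {F : Fin n → (ι → Bool) → ℝ} (hF : ∀ v, F v ∈ lowDegree ι k)
    (hsgn : ∀ v z, ∃ b : Bool, F v z = sgn b) (L : ((ι → Bool) → ℝ) →ₗ[ℝ] ℝ) (h1 : L 1 = 1)
    (hpsd : ∀ k, 2 * k ≤ r → ∀ f ∈ lowDegree ι k, 0 ≤ L (f * f)) (hd : k * d ≤ r) :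
    PEpm n d where
  pE := L ∘ₗ (aeval F).toLinearMap
  normalized := by simpa using h1
  multilin p p' h := by
    suffices aeval F p = aeval F p' by simp [this]
    choose b hb using hsgn
    funext z
    have heval : ∀ p : MvPolynomial (Fin n) ℝ,
        aeval F p z = eval (fun v => sgn (b v z)) p := by
      intro p
      have hcomp : (Pi.evalAlgHom ℝ (fun _ : ι → Bool => ℝ) z).comp (aeval F)
          = aeval fun v => sgn (b v z) :=
        algHom_ext fun v => by simp [hb]
      rw [← coe_aeval_eq_eval]
      exact DFunLike.congr_fun hcomp p
    rw [heval, heval, h fun v => b v z]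
  psd p hp := by
    have hmem := aeval_mem_lowDegree hF p
    have hdeg : 2 * (k * p.totalDegree) ≤ r :=
      le_trans (by rw [Nat.mul_left_comm]; exact Nat.mul_le_mul_left k hp) hd
    simpa [pow_two] using hpsd _ hdeg _ hmem

/-- The graph with the given edges, on the vertex set `Fin n`. -/
def bisectionGraph {q m T K L R n : ℕ} (e : Fin m → Fin 4 → Fin q × Bool) (hK : 2 * K ≤ T)
    (hL : L ≤ T) (φ : HalfVertex q m T R × Bool ≃ Fin n) : Finset (Fin n × Fin n) :=
  (Finset.univ : Finset (EdgeIndex q m T K L)).map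
    ⟨fun d => (φ (endpoints R e hK hL d).1, φ (endpoints R e hK hL d).2), fun _ _ h =>
      endpoints_injective R e hK hL
        (Prod.ext (φ.injective (congrArg Prod.fst h)) (φ.injective (congrArg Prod.snd h)))⟩

lemma card_bisectionGraph {q m T K L R n : ℕ} (e : Fin m → Fin 4 → Fin q × Bool)
    (hK : 2 * K ≤ T) (hL : L ≤ T) (φ : HalfVertex q m T R × Bool ≃ Fin n) :
    (bisectionGraph e hK hL φ).card = 8 * m * T + 8 * K * q * L := by
  simp only [bisectionGraph, Finset.card_map, Finset.card_univ, Fintype.card_sum,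
    Fintype.card_prod, Fintype.card_fin, Fintype.card_bool]
  ring

lemma ne_of_mem_bisectionGraph {q m T K L R n : ℕ} {e : Fin m → Fin 4 → Fin q × Bool}
    {hK : 2 * K ≤ T} {hL : L ≤ T} {φ : HalfVertex q m T R × Bool ≃ Fin n} {a : Fin n × Fin n}
    (ha : a ∈ bisectionGraph e hK hL φ) : a.1 ≠ a.2 := by
  obtain ⟨d, -, rfl⟩ := Finset.mem_map.1 ha
  exact fun h => endpoints_ne R e hK hL d (φ.injective h)

/-- Completeness: if the clause system expands, then some pseudoexpectation of high degree
believes that a bisection cuts few edges. -/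
theorem exists_pseudoexpectation {q m T K L R n r d : ℕ} (e : Fin m → Fin 4 → Fin q × Bool)
    (hK : 2 * K ≤ T) (hL : L ≤ T) (φ : HalfVertex q m T R × Bool ≃ Fin n) (hr : 12 ≤ r)
    (hd : 3 * d ≤ r)
    (he : ∀ A : Finset (Fin m), A.card ≤ 2 * r → 5 * A.card ≤ 2 * (touched e A).card) (κ : ℝ) :
    ∃ E : PEpm n d, (∀ v, E.satEq (X v ^ 2) 1) ∧ E.satEq (∑ v, X v) 0 ∧
      E.satEq (C κ * ∑ a ∈ bisectionGraph e hK hL φ, (X a.1 - X a.2) ^ 2)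
        (κ * (8 * m * T + 32 * K * q * L)) := by
  obtain ⟨Λ, h1, hpsd, hclause⟩ := exists_clause_functional e (by omega : 1 ≤ r) he
  have hF : ∀ v, vertexValue e (φ.symm v) ∈ lowDegree (Fin 4 × Fin q) 3 := fun v =>
    Submodule.smul_mem _ _ (halfValue_mem_lowDegree e _)
  have hsq : ∀ v, vertexValue e (φ.symm v) ^ 2 = 1 := by
    intro v
    funext z
    obtain ⟨b, hb⟩ := vertexValue_eq_sgn e (φ.symm v) z
    rw [Pi.pow_apply, hb, pow_two, sgn_mul_self, Pi.one_apply]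
  refine ⟨PEpm.ofFunctional hF (fun v z => vertexValue_eq_sgn e _ z) Λ h1 hpsd hd,
    fun v => ?_, ?_, ?_⟩
  · constructor <;> simp [PEpm.ofFunctional, hsq, h1]
  · have hsum : ∑ v, vertexValue e (φ.symm v) = 0 :=
      (Equiv.sum_comp φ.symm (vertexValue e)).trans (sum_vertexValue e)
    have haeval : aeval (fun v => vertexValue e (φ.symm v))
        (∑ v : Fin n, (X v : MvPolynomial (Fin n) ℝ)) = 0 := by
      simpa [map_sum] using hsum
    constructor
    · exact (congrArg Λ haeval).trans (map_zero Λ)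
    · show Λ (aeval _ (_ ^ 2)) = 0 ^ 2
      rw [map_pow, haeval, zero_pow two_ne_zero, map_zero, zero_pow two_ne_zero]
  · set b : ℝ := κ * (8 * m * T + 32 * K * q * L) with hb
    set Q : (Fin 4 × Fin q → Bool) → ℝ :=
      aeval (fun v => vertexValue e (φ.symm v))
        (C κ * ∑ a ∈ bisectionGraph e hK hL φ, (X a.1 - X a.2) ^ 2) with hQ
    have hQsum : Q = κ • ∑ d : EdgeIndex q m T K L, (vertexValue e (endpoints R e hK hL d).1
        - vertexValue e (endpoints R e hK hL d).2) ^ 2 := by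
      rw [hQ, map_mul, map_sum, bisectionGraph, Finset.sum_map, Algebra.smul_def, aeval_C]
      refine congrArg _ (Finset.sum_congr rfl fun d _ => ?_)
      rw [map_pow, map_sub, aeval_X, aeval_X]
      show (vertexValue e (φ.symm (φ _)) - vertexValue e (φ.symm (φ _))) ^ 2 = _
      rw [Equiv.symm_apply_apply, Equiv.symm_apply_apply]
    have hQeq : Q = b • 1 - (κ * T) • ∑ j, (1 + ∏ i, lit e j i) * pairSum e j := by
      rw [hQsum, sum_cut_vertexValue, smul_sub, smul_smul, smul_smul]
    have hQmem : Q ∈ lowDegree (Fin 4 × Fin q) 6 := by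
      rw [hQsum]
      refine Submodule.smul_mem _ _ (Submodule.sum_mem _ fun d _ => ?_)
      rw [pow_two]
      have hsub := Submodule.sub_mem _ (hF (φ (endpoints R e hK hL d).1))
        (hF (φ (endpoints R e hK hL d).2))
      simp only [Equiv.symm_apply_apply] at hsub
      exact mul_mem_lowDegree (k := 3) (l := 3) hsub hsub
    have hzero : ∀ f ∈ lowDegree (Fin 4 × Fin q) 6,
        Λ ((∑ j, (1 + ∏ i, lit e j i) * pairSum e j) * f) = 0 := by
      intro f hf
      rw [Finset.sum_mul, map_sum]
      refine Finset.sum_eq_zero fun j _ => ?_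
      rw [mul_assoc]
      exact hclause j 8 hr _ (mul_mem_lowDegree (k := 2) (l := 6) (pairSum_mem_lowDegree e j) hf)
    have hmul : ∀ f ∈ lowDegree (Fin 4 × Fin q) 6, Λ (Q * f) = b * Λ f := by
      intro f hf
      rw [hQeq, sub_mul, map_sub, smul_mul_assoc, smul_mul_assoc, map_smul, map_smul, hzero f hf,
        one_mul, smul_zero, sub_zero, smul_eq_mul]
    have hQ1 : Λ Q = b := by
      have := hmul 1 (one_mem_lowDegree _)
      rwa [mul_one, h1, mul_one] at this
    constructor
    · exact hQ1
    · show Λ (aeval _ (_ ^ 2)) = b ^ 2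
      rw [map_pow, ← hQ, pow_two, hmul Q hQmem, hQ1, pow_two]

lemma sum_sgn_eq_zero {n : ℕ} (x : Fin n → Bool)
    (hx : 2 * (Finset.univ.filter fun v => x v = true).card = n) : ∑ v, sgn (x v) = 0 := by
  have h : ∀ b : Bool, sgn b = 2 * (if b = true then 1 else 0) - 1 := by
    intro b; cases b <;> norm_num [sgn]
  simp only [h, Finset.sum_sub_distrib, ← Finset.mul_sum, Finset.sum_boole, Finset.sum_const,
    Finset.card_univ, Fintype.card_fin, nsmul_eq_mul, mul_one]
  rw [sub_eq_zero]
  exact_mod_cast hx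

/-- Soundness: in the graph of a pseudorandom clause system every bisection cuts many edges. -/
lemma Pseudorandom.le_card_cut_bisectionGraph {q m T K L R n : ℕ}
    {e : Fin m → Fin 4 → Fin q × Bool} {η κ : ℝ} (he : Pseudorandom e η) (hq : 0 < q)
    (hT : 0 < T) (hK : 2 * K ≤ T) (hL : L ≤ T) (φ : HalfVertex q m T R × Bool ≃ Fin n)
    (hκ : (m + R : ℝ) ≤ κ * (q * T)) (x : Fin n → Bool)
    (hx : 2 * (Finset.univ.filter fun v => x v = true).card = n) :
    m * T * (5 / 2 - κ ^ 2 / 4 - η)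
      ≤ (((bisectionGraph e hK hL φ).filter fun a => x a.1 ≠ x a.2).card : ℝ) := by
  have hy : ∑ w, sgn (x (φ w)) = 0 :=
    (Equiv.sum_comp φ fun v => sgn (x v)).trans (sum_sgn_eq_zero x hx)
  refine (he.le_card_cut hq hT hK hL hκ (fun w => x (φ w)) hy).trans (le_of_eq ?_)
  rw [bisectionGraph, Finset.filter_map, Finset.card_map]
  rfl

/-- For every even number of vertices there is a graph for which Sum-of-Squares of linear degree
underestimates the minimum bisection by a factor of almost `5 / 4`. -/
theorem exists_bisection_gap {c K T Z B n : ℕ} (hc : 0 < c) (hKc : K = 2560 * c ^ 2)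
    (hTc : T + (K + 1) = 3 * c * (K + 1)) (hZ : Z = 2 * 10 ^ 9 * K ^ 2) (hB : B = 4 * T + K)
    (hn : 48 * B * Z + 2 * B ^ 2 ≤ n) (hn2 : 2 ∣ n) {d : ℕ} (hd : 12 * B * Z * d ≤ n) :
    ∃ G : Finset (Fin n × Fin n), (∀ a ∈ G, a.1 ≠ a.2) ∧
      (∃ E : PEpm n d, (∀ v, E.satEq (X v ^ 2) 1) ∧ E.satEq (∑ v, X v) 0 ∧
        E.satEq (C (1 / (4 * (G.card : ℝ))) * ∑ a ∈ G, (X a.1 - X a.2) ^ 2)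
          (1 / 4 + 1 / (4 * (c : ℝ)))) ∧
      ∀ x : Fin n → Bool, 2 * (Finset.univ.filter fun v => x v = true).card = n →
        5 / 16 - 1 / (4 * (c : ℝ)) ≤ ((G.filter fun a => x a.1 ≠ x a.2).card : ℝ) / G.card := by
  obtain ⟨h, rfl⟩ := hn2
  have hKpos : 1 ≤ K := by rw [hKc]; have := pow_pos hc 2; omega
  have hT2 : 2 * (K + 1) ≤ T := by nlinarith
  have hBpos : 0 < B := by omega
  have hZpos : 0 < Z := by rw [hZ]; positivity
  have hq : B ≤ h / B := by rw [Nat.le_div_iff_mul_le hBpos]; nlinarith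
  have hR : h % B ≤ h / B := (Nat.mod_lt h hBpos).le.trans hq
  have hh : B * (h / B) + h % B = h := Nat.div_add_mod h B
  have hr : 12 ≤ 2 * h / (4 * B * Z) := by
    rw [Nat.le_div_iff_mul_le (by positivity)]; nlinarith
  have hrd : 3 * d ≤ 2 * h / (4 * B * Z) := by
    rw [Nat.le_div_iff_mul_le (by positivity)]; nlinarith
  have hrZ : 2 * h / (4 * B * Z) * Z ≤ h / B := by
    rw [Nat.le_div_iff_mul_le hBpos]
    have := Nat.div_mul_le_self (2 * h) (4 * B * Z)
    nlinarith
  generalize 2 * h / (4 * B * Z) = r at hr hrd hrZ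
  generalize h / B = q at hq hR hh hrZ
  generalize h % B = R at hR hh
  have hqpos : 0 < q := hBpos.trans_le hq
  have hc' : (1 : ℝ) ≤ c := by exact_mod_cast hc
  have hq' : (0 : ℝ) < q := by exact_mod_cast hqpos
  have hK' : (1 : ℝ) ≤ K := by exact_mod_cast hKpos
  have hT' : (T : ℝ) = (3 * c - 1) * (K + 1) := by
    have : (T : ℝ) + (K + 1) = 3 * c * (K + 1) := by exact_mod_cast hTc
    linarith
  obtain ⟨e, hexp, hpr⟩ := exists_clause_system (ρ := 2 * r) (η := 1 / (2 * c)) hqpos hKpos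
    (by rw [hZ] at hrZ; nlinarith) (by positivity)
    (by rw [div_le_iff₀ (by positivity)]; linarith)
    (by rw [hKc]; push_cast; field_simp; norm_num)
  have hcard : Fintype.card (HalfVertex q (K * q) T R × Bool) = Fintype.card (Fin (2 * h)) := by
    simp only [Fintype.card_prod, Fintype.card_sum, Fintype.card_fin, Fintype.card_bool]
    rw [← hh, hB]
    ring
  let φ := Fintype.equivOfCardEq hcard
  have h2K : 2 * K ≤ T := by omega
  have hL : K + 1 ≤ T := by omega
  have hG : ((bisectionGraph e h2K hL φ).card : ℝ) = 24 * c * K * q * (K + 1) := by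
    rw [card_bisectionGraph]
    push_cast
    rw [hT']
    ring
  refine ⟨bisectionGraph e h2K hL φ, fun a => ne_of_mem_bisectionGraph, ?_, fun x hx => ?_⟩
  · obtain ⟨E, hsq, hsum, hcut⟩ := exists_pseudoexpectation e h2K hL φ hr hrd hexp
      (1 / (4 * ((bisectionGraph e h2K hL φ).card : ℝ)))
    refine ⟨E, hsq, hsum, ?_⟩
    convert hcut using 1
    rw [hG, hT']
    push_cast
    field_simp
    ring
  · have hκ : ((K * q : ℕ) + R : ℝ) ≤ 1 / (2 * c) * (q * T) := by
      have hRq : (R : ℝ) ≤ q := by exact_mod_cast hR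
      rw [hT', div_mul_eq_mul_div, le_div_iff₀ (by positivity)]
      push_cast
      have hqK : (0 : ℝ) ≤ q * (K + 1) * (c - 1) := by
        have : (0 : ℝ) ≤ c - 1 := by linarith
        positivity
      nlinarith
    have hcut := hpr.le_card_cut_bisectionGraph hqpos (by omega) h2K hL φ hκ x hx
    rw [hG, le_div_iff₀ (by positivity)]
    refine le_trans ?_ hcut
    rw [hT']
    push_cast
    have hscalar : (5 / 16 - 1 / (4 * (c : ℝ))) * (24 * c)
        ≤ (3 * c - 1) * (5 / 2 - (1 / (2 * c)) ^ 2 / 4 - 1 / (2 * c)) := by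
      rw [← sub_nonneg]
      have : (3 * c - 1) * (5 / 2 - (1 / (2 * c)) ^ 2 / 4 - 1 / (2 * c))
          - (5 / 16 - 1 / (4 * (c : ℝ))) * (24 * c)
          = (32 * c ^ 2 + 5 * c + 1) / (16 * (c : ℝ) ^ 2) := by
        field_simp
        ring
      rw [this]
      positivity
    calc _ = (5 / 16 - 1 / (4 * (c : ℝ))) * (24 * c) * (K * q * (K + 1)) := by ring
      _ ≤ (3 * c - 1) * (5 / 2 - (1 / (2 * c)) ^ 2 / 4 - 1 / (2 * c)) * (K * q * (K + 1)) := by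
          gcongr
      _ = _ := by ring

lemma uprob_unit {p : Unit → Prop} (hp : p ()) : uprob p = 1 := by
  classical
  rw [uprob, Finset.filter_true_of_mem fun u _ => hp]
  simp

/-- a degree-Ω(n) SOS lower bound for Min-Bisection with approximation factor
5/4 - ε, for ε = 1/(4c), c an even positive integer. -/
theorem stmt12 :
    ∀ c : ℕ, 0 < c → Even c →
      ∃ cdeg : ℝ, 0 < cdeg ∧
        ∀ δ : ℝ, 0 < δ →
          ∃ N : ℕ, ∀ n : ℕ, N ≤ n → 2 ∣ n →
            ∃ (Ω : Type) (inst : Fintype Ω) (G : Ω → Finset (Fin n × Fin n)),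
              (∀ ω : Ω, ∀ e ∈ G ω, e.1 ≠ e.2) ∧
              1 - δ ≤
                @uprob Ω inst (fun ω : Ω =>
                  -- completeness: a degree-Ω(n) pseudoexpectation cutting a 1/4 + 1/(4c)
                  -- fraction of the edges
                  (∃ E : PEpm n ⌊cdeg * (n : ℝ)⌋₊,
                    (∀ v : Fin n, E.satEq (MvPolynomial.X v ^ 2) 1) ∧
                    E.satEq (∑ v : Fin n, MvPolynomial.X v) 0 ∧
                    E.satEq
                      (MvPolynomial.C (1 / (4 * ((G ω).card : ℝ))) *
                        ∑ e ∈ G ω, (MvPolynomial.X e.1 - MvPolynomial.X e.2) ^ 2)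
                      (1 / 4 + 1 / (4 * (c : ℝ)))) ∧
                  -- soundness: every genuine bisection cuts at least a 5/16 - 1/(4c)
                  -- fraction of the edges
                  (∀ x : Fin n → Bool,
                    2 * (Finset.univ.filter fun v => x v = true).card = n →
                    5 / 16 - 1 / (4 * (c : ℝ)) ≤
                      (((G ω).filter fun e => x e.1 ≠ x e.2).card : ℝ) / ((G ω).card : ℝ))) := by
  intro c hc _
  obtain ⟨K, hK⟩ : ∃ K, K = 2560 * c ^ 2 := ⟨_, rfl⟩
  obtain ⟨T, hT⟩ : ∃ T, T + (K + 1) = 3 * c * (K + 1) :=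
    ⟨3 * c * (K + 1) - (K + 1), Nat.sub_add_cancel (Nat.le_mul_of_pos_left _ (by omega))⟩
  obtain ⟨Z, hZ⟩ : ∃ Z, Z = 2 * 10 ^ 9 * K ^ 2 := ⟨_, rfl⟩
  obtain ⟨B, hB⟩ : ∃ B, B = 4 * T + K := ⟨_, rfl⟩
  have hKpos : 0 < K := by rw [hK]; positivity
  have hZpos : (0 : ℝ) < Z := by rw [hZ]; positivity
  have hBpos : (0 : ℝ) < B := by rw [hB]; positivity
  refine ⟨1 / (12 * B * Z), by positivity, fun δ hδ => ⟨48 * B * Z + 2 * B ^ 2, fun n hn h2 => ?_⟩⟩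
  have hd : 12 * B * Z * ⌊1 / (12 * B * Z : ℝ) * n⌋₊ ≤ n := by
    have h := Nat.floor_le (by positivity : 0 ≤ 1 / (12 * B * Z : ℝ) * n)
    generalize ⌊1 / (12 * B * Z : ℝ) * n⌋₊ = d at h
    rw [div_mul_eq_mul_div, one_mul, le_div_iff₀ (by positivity), mul_comm] at h
    exact_mod_cast h
  obtain ⟨G, hne, hgap⟩ := exists_bisection_gap hc hK hT hZ hB hn h2 hd
  refine ⟨Unit, inferInstance, fun _ => G, fun _ => hne, ?_⟩
  rw [uprob_unit hgap]
  linarith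
end

section
/- Fix a finite set D and integers k, n, m = Δn. Choose m scopes independently and uniformly at random, each scope being an ordered tuple of k distinct variables from a set X of n variables. Then there is a universal constant C such that, with probability 1 − o(1) over the choice of scopes, the following holds: for every assignment f : X → D, the total variation distance between Ψ_f and the product distribution φ_f^{⊗k} is at most η₁ = C·(√(log|D|/Δ) + k²/n), where φ_f is the empirical distribution on D of the values of f (φ_f(u) is the fraction of x ∈ X with f(x) = u) and Ψ_f is the empirical distribution on D^k obtained by choosing a uniformly random scope C among the m scopes and forming f(C). -/
open Finset

theorem one_sub_uprob_not_le {Ω : Type} [Fintype Ω] [Nonempty Ω] (p : Ω → Prop) :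
    1 - uprob (fun ω => ¬ p ω) ≤ uprob p := by
  classical
  have hcard : (0 : ℝ) < Fintype.card Ω := by exact_mod_cast Fintype.card_pos
  have h := Finset.card_filter_add_card_filter_not (s := (univ : Finset Ω)) p
  have h' : ((univ.filter p).card : ℝ) + ((univ.filter fun ω => ¬ p ω).card : ℝ)
      = Fintype.card Ω := by
    rw [← Finset.card_univ]; exact_mod_cast h
  unfold uprob
  rw [sub_le_iff_le_add, ← add_div, le_div_iff₀ hcard, one_mul, ← h']
  apply le_of_eq
  congr!

theorem uprob_mono {Ω : Type} [Fintype Ω] {p q : Ω → Prop} (h : ∀ ω, p ω → q ω) :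
    uprob p ≤ uprob q := by
  classical
  unfold uprob
  gcongr with ω
  exact h ω

/-- The union bound. -/
theorem uprob_exists_le {Ω ι : Type} [Fintype Ω] [Fintype ι] (p : ι → Ω → Prop) (b : ℝ)
    (h : ∀ i, uprob (p i) ≤ b) : uprob (fun ω => ∃ i, p i ω) ≤ Fintype.card ι * b := by
  classical
  calc uprob (fun ω => ∃ i, p i ω) ≤ ∑ i, uprob (p i) := by
        unfold uprob
        rw [← Finset.sum_div]
        gcongr
        norm_cast
        refine le_trans (Finset.card_le_card ?_) Finset.card_biUnion_le
        intro ω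
        simp
    _ ≤ ∑ _i : ι, b := Finset.sum_le_sum fun i _ => h i
    _ = Fintype.card ι * b := by simp

theorem exp_mul_le_cosh_add_mul_sinh (t : ℝ) {x : ℝ} (hx : |x| ≤ 1) :
    Real.exp (t * x) ≤ Real.cosh t + x * Real.sinh t := by
  obtain ⟨h₁, h₂⟩ := abs_le.mp hx
  have h := convexOn_exp.2 (Set.mem_univ t) (Set.mem_univ (-t))
    (show 0 ≤ (1 + x) / 2 by linarith) (show 0 ≤ (1 - x) / 2 by linarith) (by ring)
  simp only [smul_eq_mul] at h
  rw [Real.cosh_eq, Real.sinh_eq]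
  calc Real.exp (t * x) = Real.exp ((1 + x) / 2 * t + (1 - x) / 2 * -t) := by ring_nf
    _ ≤ _ := h
    _ = _ := by ring

/-- Hoeffding's inequality for independent uniform samples from a finite set. -/
theorem uprob_lt_sum_le {E : Type} [Fintype E] [Nonempty E] (m : ℕ) (X : E → ℝ)
    (hX : ∀ e, |X e| ≤ 1) (hsum : ∑ e, X e = 0) {t : ℝ} (ht : 0 ≤ t) :
    uprob (fun ω : Fin m → E => m * t < ∑ j, X (ω j)) ≤ Real.exp (-(m * t ^ 2 / 2)) := by
  classical
  have hE : (0 : ℝ) < Fintype.card E := by exact_mod_cast Fintype.card_pos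
  have hmgf : ∑ e, Real.exp (t * X e) ≤ Fintype.card E * Real.exp (t ^ 2 / 2) :=
    calc ∑ e, Real.exp (t * X e) ≤ ∑ e, (Real.cosh t + X e * Real.sinh t) :=
          Finset.sum_le_sum fun e _ => exp_mul_le_cosh_add_mul_sinh t (hX e)
      _ = Fintype.card E * Real.cosh t := by
          rw [Finset.sum_add_distrib, ← Finset.sum_mul, hsum]; simp
      _ ≤ _ := by gcongr; exact Real.cosh_le_exp_half_sq t
  have hprod : ∑ ω : Fin m → E, Real.exp (t * ∑ j, X (ω j)) = (∑ e, Real.exp (t * X e)) ^ m := by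
    rw [Finset.sum_pow', ← Fintype.piFinset_univ]
    refine Finset.sum_congr rfl fun ω _ => ?_
    rw [Finset.mul_sum, Real.exp_sum]
  have hmarkov : ((univ.filter fun ω : Fin m → E => m * t < ∑ j, X (ω j)).card : ℝ)
      * Real.exp (t * (m * t)) ≤ ∑ ω : Fin m → E, Real.exp (t * ∑ j, X (ω j)) := by
    rw [← nsmul_eq_mul, ← Finset.sum_const]
    refine (Finset.sum_le_sum fun ω hω => ?_).trans
      (Finset.sum_le_sum_of_subset_of_nonneg (Finset.filter_subset _ _)
        fun _ _ _ => (Real.exp_pos _).le)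
    have := (Finset.mem_filter.mp hω).2
    gcongr
  have hpow : (∑ e, Real.exp (t * X e)) ^ m
      ≤ (Fintype.card E : ℝ) ^ m * Real.exp (m * t ^ 2 / 2) := by
    calc _ ≤ (Fintype.card E * Real.exp (t ^ 2 / 2)) ^ m :=
          pow_le_pow_left₀ (Finset.sum_nonneg fun _ _ => (Real.exp_pos _).le) hmgf m
      _ = _ := by rw [mul_pow, ← Real.exp_nat_mul]; ring_nf
  unfold uprob
  rw [div_le_iff₀ (by exact_mod_cast Fintype.card_pos)]
  have hΩ : (Fintype.card (Fin m → E) : ℝ) = (Fintype.card E : ℝ) ^ m := by simp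
  rw [hΩ]
  have hexp : Real.exp (m * t ^ 2 / 2)
      = Real.exp (-(m * t ^ 2 / 2)) * Real.exp (t * (m * t)) := by
    rw [← Real.exp_add]; ring_nf
  refine le_of_mul_le_mul_right ?_ (Real.exp_pos (t * (m * t)))
  calc _ ≤ (Fintype.card E : ℝ) ^ m * Real.exp (m * t ^ 2 / 2) := by
        refine le_trans (le_of_eq ?_) (hmarkov.trans (hprod.le.trans hpow))
        congr!
    _ = _ := by rw [hexp]; ring

/-- The total variation distance is the largest excess of one distribution over the other. -/
theorem half_sum_abs_sub_le {α : Type*} [Fintype α] {μ ν : α → ℝ} {t : ℝ}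
    (hsum : ∑ a, μ a = ∑ a, ν a) (h : ∀ A : Finset α, ∑ a ∈ A, μ a - ∑ a ∈ A, ν a ≤ t) :
    1 / 2 * ∑ a, |μ a - ν a| ≤ t := by
  classical
  have hA := h (univ.filter fun a => ν a ≤ μ a)
  rw [← Finset.sum_sub_distrib, Finset.sum_filter] at hA
  have habs : ∀ a, |μ a - ν a| = 2 * (if ν a ≤ μ a then μ a - ν a else 0) - (μ a - ν a) := by
    intro a
    split_ifs with hle
    · rw [abs_of_nonneg (by linarith)]; ring
    · rw [abs_of_neg (by linarith)]; ring
  simp_rw [habs]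
  rw [Finset.sum_sub_distrib, ← Finset.mul_sum, Finset.sum_sub_distrib, hsum]
  linarith

/-- A uniform `k`-tuple is injective with probability at least `1 - k² / n`. -/
theorem one_sub_descFactorial_div_pow_le {k n : ℕ} (hn : 0 < n) (hkn : k ≤ n) :
    1 - (n.descFactorial k : ℝ) / (n : ℝ) ^ k ≤ (k : ℝ) ^ 2 / n := by
  have hn' : (0 : ℝ) < n := by exact_mod_cast hn
  have hkn' : (k : ℝ) ≤ n := by exact_mod_cast hkn
  have hratio : (k : ℝ) / n ≤ 1 := (div_le_one hn').mpr hkn'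
  have hpow : ((n : ℝ) - k) ^ k ≤ n.descFactorial k := by
    calc ((n : ℝ) - k) ^ k ≤ ((n + 1 - k : ℕ) : ℝ) ^ k := by
          apply pow_le_pow_left₀ (by linarith)
          rw [Nat.cast_sub (by omega)]; push_cast; linarith
      _ ≤ _ := by exact_mod_cast Nat.pow_sub_le_descFactorial n k
  have hbern := one_add_mul_le_pow (show (-2 : ℝ) ≤ -(k / n) by linarith) k
  have heq : (1 + -((k : ℝ) / n)) ^ k = ((n : ℝ) - k) ^ k / (n : ℝ) ^ k := by
    rw [← div_pow]; congr 1; field_simp; ring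
  have hdiv : ((n : ℝ) - k) ^ k / (n : ℝ) ^ k ≤ (n.descFactorial k : ℝ) / (n : ℝ) ^ k := by
    gcongr
  have hsq : (k : ℝ) * -(k / n) = -((k : ℝ) ^ 2 / n) := by ring
  linarith

theorem card_filter_embedding_div_sub_le {k n : ℕ} (hn : 0 < n) (hkn : k ≤ n)
    (p : (Fin k → Fin n) → Prop) [DecidablePred p] :
    ((univ.filter fun e : Fin k ↪ Fin n => p e).card : ℝ) / Fintype.card (Fin k ↪ Fin n)
      - ((univ.filter p).card : ℝ) / (n : ℝ) ^ k ≤ (k : ℝ) ^ 2 / n := by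
  have hle : (univ.filter fun e : Fin k ↪ Fin n => p e).card ≤ (univ.filter p).card :=
    Finset.card_le_card_of_injOn (fun e => (e : Fin k → Fin n)) (fun e he => by simpa using he)
      DFunLike.coe_injective.injOn
  have hcard : Fintype.card (Fin k ↪ Fin n) = n.descFactorial k := by
    simp [Fintype.card_embedding_eq]
  have hall : (univ.filter fun e : Fin k ↪ Fin n => p e).card ≤ n.descFactorial k := by
    rw [← hcard]; exact Finset.card_le_univ _
  have hpos : (0 : ℝ) < n.descFactorial k := by exact_mod_cast Nat.descFactorial_pos.mpr hkn
  have hpow : (0 : ℝ) < (n : ℝ) ^ k := by positivity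
  have hdesc : (n.descFactorial k : ℝ) ≤ (n : ℝ) ^ k := by
    exact_mod_cast Nat.descFactorial_le_pow n k
  rw [hcard]
  set a := (univ.filter fun e : Fin k ↪ Fin n => p e).card
  calc (a : ℝ) / n.descFactorial k - ((univ.filter p).card : ℝ) / (n : ℝ) ^ k
      ≤ (a : ℝ) / n.descFactorial k - (a : ℝ) / (n : ℝ) ^ k := by gcongr
    _ = a * (1 / n.descFactorial k - 1 / (n : ℝ) ^ k) := by ring
    _ ≤ n.descFactorial k * (1 / n.descFactorial k - 1 / (n : ℝ) ^ k) := by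
        gcongr
        exact sub_nonneg.mpr (one_div_le_one_div_of_le hpos hdesc)
    _ = 1 - (n.descFactorial k : ℝ) / (n : ℝ) ^ k := by field_simp
    _ ≤ _ := one_sub_descFactorial_div_pow_le hn hkn

theorem sum_card_filter_eq {α β : Type*} [Fintype α] [DecidableEq β] (g : α → β)
    (A : Finset β) :
    ∑ u ∈ A, ((univ.filter fun a => g a = u).card : ℝ)
      = ((univ.filter fun a => g a ∈ A).card : ℝ) := by
  have h := Finset.card_eq_sum_card_fiberwise (f := g) (s := univ.filter fun a => g a ∈ A)
    (t := A) (fun a ha => by simpa using ha)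
  rw [h]
  push_cast
  refine Finset.sum_congr rfl fun u hu => ?_
  congr 2
  ext a
  simp only [Finset.mem_filter, Finset.mem_univ, true_and]
  exact ⟨fun h => ⟨h ▸ hu, h⟩, fun h => h.2⟩

theorem prod_card_filter_div_eq {D : Type*} [DecidableEq D] {k n : ℕ} (f : Fin n → D)
    (u : Fin k → D) :
    ∏ i, (((univ.filter fun x : Fin n => f x = u i).card : ℝ) / n)
      = ((univ.filter fun g : Fin k → Fin n => (fun i => f (g i)) = u).card : ℝ)
        / (n : ℝ) ^ k := by
  rw [Finset.prod_div_distrib, Finset.prod_const, Finset.card_univ, Fintype.card_fin]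
  congr 1
  rw [← Nat.cast_prod, ← Fintype.card_piFinset]
  congr 2
  ext g
  simp [funext_iff]

/-- If every event is represented in the sample with excess at most `t`, then the empirical
scope distribution is close to the product distribution. -/
theorem half_sum_abs_scope_sub_prod_le {D : Type*} [Fintype D] [DecidableEq D] {k m n : ℕ}
    (hm : 0 < m) (hn : 0 < n) (hkn : k ≤ n) (ω : Fin m → (Fin k ↪ Fin n)) (f : Fin n → D) {t : ℝ}
    (h : ∀ A : Finset (Fin k → D),
      ((univ.filter fun j => (fun i => f (ω j i)) ∈ A).card : ℝ) / m
        - ((univ.filter fun e : Fin k ↪ Fin n => (fun i => f (e i)) ∈ A).card : ℝ)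
          / Fintype.card (Fin k ↪ Fin n) ≤ t) :
    1 / 2 * ∑ u : Fin k → D,
      |((univ.filter fun j => (fun i => f (ω j i)) = u).card : ℝ) / m
        - ∏ i, (((univ.filter fun x : Fin n => f x = u i).card : ℝ) / n)|
      ≤ t + (k : ℝ) ^ 2 / n := by
  have hm' : (m : ℝ) ≠ 0 := by exact_mod_cast hm.ne'
  have hn' : (n : ℝ) ≠ 0 := by exact_mod_cast hn.ne'
  simp_rw [prod_card_filter_div_eq]
  apply half_sum_abs_sub_le
  · rw [← Finset.sum_div, ← Finset.sum_div, sum_card_filter_eq, sum_card_filter_eq]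
    simp [hm', hn']
  · intro A
    rw [← Finset.sum_div, ← Finset.sum_div, sum_card_filter_eq, sum_card_filter_eq]
    have h₂ := card_filter_embedding_div_sub_le hn hkn
      (fun g : Fin k → Fin n => (fun i => f (g i)) ∈ A)
    have h₁ := h A
    linarith

/-- Hoeffding's inequality for the frequency of an event among independent uniform samples. -/
theorem uprob_lt_frequency_sub_le {E : Type} [Fintype E] [Nonempty E] {m : ℕ} (hm : 0 < m)
    (p : E → Prop) [DecidablePred p] {t : ℝ} (ht : 0 ≤ t) :
    uprob (fun ω : Fin m → E => t < ((univ.filter fun j => p (ω j)).card : ℝ) / m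
      - ((univ.filter p).card : ℝ) / Fintype.card E) ≤ Real.exp (-(m * t ^ 2 / 2)) := by
  have hm' : (0 : ℝ) < m := by exact_mod_cast hm
  have hE : (0 : ℝ) < Fintype.card E := by exact_mod_cast Fintype.card_pos
  set q : ℝ := ((univ.filter p).card : ℝ) / Fintype.card E with hq
  have hq0 : 0 ≤ q := by positivity
  have hq1 : q ≤ 1 := by
    rw [hq, div_le_one hE]; exact_mod_cast Finset.card_le_univ _
  refine le_trans (uprob_mono ?_)
    (uprob_lt_sum_le m (fun e => (if p e then 1 else 0) - q) ?_ ?_ ht)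
  · intro ω hω
    rw [Finset.sum_sub_distrib, Finset.sum_boole, Finset.sum_const, Finset.card_univ,
      Fintype.card_fin, nsmul_eq_mul]
    rw [lt_sub_iff_add_lt, lt_div_iff₀ hm'] at hω
    linarith
  · intro e
    rw [abs_le]
    split_ifs <;> constructor <;> linarith
  · rw [Finset.sum_sub_distrib, Finset.sum_boole, Finset.sum_const, Finset.card_univ,
      nsmul_eq_mul, hq]
    field_simp
    ring

theorem half_sum_abs_scope_sub_prod_eq_zero {D : Type*} [Fintype D] [DecidableEq D] [Nonempty D]
    [Subsingleton D] {k m n : ℕ} (hm : 0 < m) (hn : 0 < n) (ω : Fin m → (Fin k ↪ Fin n))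
    (f : Fin n → D) :
    1 / 2 * ∑ u : Fin k → D,
      |((univ.filter fun j => (fun i => f (ω j i)) = u).card : ℝ) / m
        - ∏ i, (((univ.filter fun x : Fin n => f x = u i).card : ℝ) / n)| = 0 := by
  have hm' : (m : ℝ) ≠ 0 := by exact_mod_cast hm.ne'
  have hn' : (n : ℝ) ≠ 0 := by exact_mod_cast hn.ne'
  have h₁ : ∀ u : Fin k → D, (univ.filter fun j => (fun i => f (ω j i)) = u) = univ :=
    fun u => Finset.filter_true_of_mem fun _ _ => Subsingleton.elim _ _
  have h₂ : ∀ d : D, (univ.filter fun x => f x = d) = univ :=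
    fun d => Finset.filter_true_of_mem fun _ _ => Subsingleton.elim _ _
  simp [h₁, h₂, hm', hn']

theorem uprob_exists_excess_le {D : Type} [Fintype D] [DecidableEq D] {k m n : ℕ} (hm : 0 < m)
    (hkn : k ≤ n) {t : ℝ} (ht : 0 ≤ t) :
    uprob (fun ω : Fin m → (Fin k ↪ Fin n) => ∃ fA : (Fin n → D) × Finset (Fin k → D),
      t < ((univ.filter fun j => (fun i => fA.1 (ω j i)) ∈ fA.2).card : ℝ) / m
        - ((univ.filter fun e : Fin k ↪ Fin n => (fun i => fA.1 (e i)) ∈ fA.2).card : ℝ)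
          / Fintype.card (Fin k ↪ Fin n))
      ≤ Fintype.card ((Fin n → D) × Finset (Fin k → D)) * Real.exp (-(m * t ^ 2 / 2)) := by
  have : Nonempty (Fin k ↪ Fin n) := ⟨Fin.castLEEmb hkn⟩
  apply uprob_exists_le
  intro fA
  exact uprob_lt_frequency_sub_le hm
    (fun e : Fin k ↪ Fin n => (fun i => fA.1 (e i)) ∈ fA.2) ht

/-- with high probability over m = Δn random scopes, for every assignment
f : X → D the empirical scope distribution Ψ_f is η₁-close in total variation to the product
distribution φ_f^⊗k. -/
theorem stmt13 :
    ∃ Cc : ℝ, 0 < Cc ∧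
      ∀ (D : Type) [Fintype D] [DecidableEq D] [Nonempty D],
        ∀ (k Δ : ℕ), 0 < k → 0 < Δ →
          ∀ δ : ℝ, 0 < δ →
            ∃ N : ℕ, ∀ n : ℕ, N ≤ n →
              1 - δ ≤
                uprob (fun ω : Fin (Δ * n) → (Fin k ↪ Fin n) =>
                  ∀ f : Fin n → D,
                    (1 / 2 : ℝ) * ∑ u : Fin k → D,
                      |(((Finset.univ.filter fun j : Fin (Δ * n) =>
                            (fun i => f (ω j i)) = u).card : ℝ) / ((Δ * n : ℕ) : ℝ))
                        - ∏ i : Fin k,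
                            (((Finset.univ.filter fun x : Fin n => f x = u i).card : ℝ)
                              / (n : ℝ))|
                      ≤ Cc * (Real.sqrt (Real.log (Fintype.card D) / (Δ : ℝ))
                          + (k : ℝ) ^ 2 / (n : ℝ))) := by
  refine ⟨2, two_pos, fun D _ _ _ k Δ _ hΔ δ hδ => ?_⟩
  set K : ℝ := (Fintype.card (Finset (Fin k → D)) : ℝ) with hK
  have hΔ' : (0 : ℝ) < Δ := by exact_mod_cast hΔ
  have hlim : Filter.Tendsto (fun n : ℕ => K * (1 / 2 : ℝ) ^ n) Filter.atTop (nhds 0) := by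
    simpa using (tendsto_pow_atTop_nhds_zero_of_lt_one (r := (1 / 2 : ℝ)) (by norm_num)
      (by norm_num)).const_mul K
  obtain ⟨N, hN⟩ := Filter.eventually_atTop.mp (hlim.eventually (gt_mem_nhds hδ))
  refine ⟨max N (k + 1), fun n hn => ?_⟩
  have hNn := hN n (le_trans (le_max_left _ _) hn)
  have hkn : k + 1 ≤ n := le_trans (le_max_right _ _) hn
  have hn0 : 0 < n := by omega
  have hm : 0 < Δ * n := Nat.mul_pos hΔ hn0
  have : Nonempty (Fin k ↪ Fin n) := ⟨Fin.castLEEmb (by omega)⟩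
  refine le_trans ?_ (one_sub_uprob_not_le _)
  rw [sub_le_sub_iff_left]
  rcases subsingleton_or_nontrivial D with hD | hD
  · refine le_trans (uprob_mono (q := fun _ => False) ?_) ?_
    · intro ω h
      refine h fun f => ?_
      rw [half_sum_abs_scope_sub_prod_eq_zero hm hn0]
      positivity
    · simpa [uprob] using hδ.le
  have hd : (2 : ℝ) ≤ Fintype.card D := by exact_mod_cast Fintype.one_lt_card (α := D)
  have hlog : 0 ≤ Real.log (Fintype.card D) := Real.log_nonneg (by linarith)
  set t : ℝ := 2 * Real.sqrt (Real.log (Fintype.card D) / Δ) with ht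
  have ht0 : 0 ≤ t := by positivity
  refine le_trans (uprob_mono (q := fun ω => ∃ fA : (Fin n → D) × Finset (Fin k → D),
    t < ((univ.filter fun j => (fun i => fA.1 (ω j i)) ∈ fA.2).card : ℝ) / ((Δ * n : ℕ) : ℝ)
      - ((univ.filter fun e : Fin k ↪ Fin n => (fun i => fA.1 (e i)) ∈ fA.2).card : ℝ)
        / Fintype.card (Fin k ↪ Fin n)) ?_) ?_
  · intro ω
    contrapose!
    intro h f
    refine (half_sum_abs_scope_sub_prod_le hm hn0 (by omega) ω f fun A => h (f, A)).trans ?_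
    have : (0 : ℝ) ≤ (k : ℝ) ^ 2 / n := by positivity
    rw [ht]
    linarith
  · refine (uprob_exists_excess_le hm (by omega) ht0).trans ?_
    have hexp : Real.exp (-(((Δ * n : ℕ) : ℝ) * t ^ 2 / 2))
        = ((Fintype.card D : ℝ) ^ n)⁻¹ * ((Fintype.card D : ℝ) ^ n)⁻¹ := by
      have hsq : ((Δ * n : ℕ) : ℝ) * t ^ 2 / 2
          = n * Real.log (Fintype.card D) + n * Real.log (Fintype.card D) := by
        rw [ht, mul_pow, Real.sq_sqrt (by positivity)]
        push_cast
        field_simp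
        ring
      rw [hsq, neg_add, Real.exp_add, Real.exp_neg, Real.exp_nat_mul, Real.exp_log (by linarith)]
    have hpow : (0 : ℝ) < (Fintype.card D : ℝ) ^ n := by positivity
    have hcard : (Fintype.card ((Fin n → D) × Finset (Fin k → D)) : ℝ)
        = (Fintype.card D : ℝ) ^ n * K := by
      rw [Fintype.card_prod, Nat.cast_mul, hK]
      simp
    rw [hexp, hcard]
    calc (Fintype.card D : ℝ) ^ n * K
          * (((Fintype.card D : ℝ) ^ n)⁻¹ * ((Fintype.card D : ℝ) ^ n)⁻¹)
        = K * ((Fintype.card D : ℝ) ^ n)⁻¹ := by field_simp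
      _ ≤ K * (1 / 2 : ℝ) ^ n := by
          rw [one_div, inv_pow]
          gcongr
      _ ≤ δ := hNn.le
end
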